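/- arXiv:1405.7972 — 2 statements merged into one kernel-verified Lean document; each statement's English description precedes it below -/
import Mathlib

section
/- Let G be a directed graph with a source q. Then the Stanley–Reisner complex Σ_G^q of the oriented cut ideal C_G^q is a shellable (pure) simplicial complex; consequently Σ_G^q is Cohen–Macaulay, i.e., the Stanley–Reisner ring S/C_G^q is a Cohen–Macaulay ring. -/
/-!
STATEMENT 10: The Stanley–Reisner complex `Σ_G^q` of the oriented cut ideal of a
directed graph with source `q` is pure shellable; consequently the Stanley–Reisner
ring `S/C_G^q` is Cohen–Macaulay.
-/

open Finset MvPolynomial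

noncomputable section

open scoped Classical

/-- A finite directed multigraph without loops. -/
structure DirGraph (V E : Type) where
  head : E → V
  tail : E → V
  no_loop : ∀ e, head e ≠ tail e

namespace DirGraph

variable {V E : Type} (G : DirGraph V E)

/-- Reachability by a directed path using edges from `T`. -/
def ReachIn (T : Finset E) (u v : V) : Prop :=
  Relation.ReflTransGen (fun a b => ∃ e ∈ T, G.tail e = a ∧ G.head e = b) u v

variable [Fintype V] [Fintype E]

/-- The oriented cut ideal `C_G^q`. -/
def cutIdeal (k : Type) [Field k] (q : V) : Ideal (MvPolynomial E k) :=
  Ideal.span {p | ∃ A : Finset V, A.Nonempty ∧ q ∉ A ∧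
    p = ∏ e ∈ univ.filter (fun e => G.head e ∈ A ∧ G.tail e ∉ A), X e}

end DirGraph

/-- `τ` is a face of the Stanley–Reisner complex of `I`. -/
def IsSRFace {E k : Type} [Field k] (I : Ideal (MvPolynomial E k)) (τ : Finset E) :
    Prop := (∏ e ∈ τ, X e) ∉ I

/-- `τ` is a facet of the Stanley–Reisner complex of `I`. -/
def IsSRFacet {E k : Type} [Field k] (I : Ideal (MvPolynomial E k)) (τ : Finset E) :
    Prop := IsSRFace I τ ∧ ∀ τ' : Finset E, τ ⊂ τ' → ¬ IsSRFace I τ'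

/-- The Stanley–Reisner complex of `I` is pure and shellable: its facets all have the
same cardinality and can be listed as `F₁, …, F_s` so that for all `i < j` there are
`k < j` and `x ∈ F_j` with `F_i ∩ F_j ⊆ F_k ∩ F_j = F_j ∖ {x}` (i.e. the intersection
of `F_j` with the union of the previous facets is a nonempty union of facets of the
boundary of `F_j`). -/
def IsPureShellable {E k : Type} [Field k] [DecidableEq E]
    (I : Ideal (MvPolynomial E k)) : Prop :=
  ∃ l : List (Finset E), l.Nodup ∧ (∀ τ : Finset E, IsSRFacet I τ ↔ τ ∈ l) ∧
    (∀ τ ∈ l, ∀ τ' ∈ l, τ.card = τ'.card) ∧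
    ∀ i j : Fin l.length, i < j → 1 ≤ j.1 →
      ∃ k' : Fin l.length, k' < j ∧ ∃ x ∈ l.get j,
        l.get i ∩ l.get j ⊆ l.get k' ∩ l.get j ∧
        l.get k' ∩ l.get j = (l.get j).erase x

/-- Cohen–Macaulayness of the (standard graded) quotient `S/I`: there is a regular
sequence on `S/I` of elements of the irrelevant maximal ideal whose length equals the
Krull dimension of `S/I`. -/
def IsCohenMacaulayQuotient {E k : Type} [Field k]
    (I : Ideal (MvPolynomial E k)) : Prop :=
  ∃ rs : List (MvPolynomial E k),
    (∀ r ∈ rs, r ∈ Ideal.span (Set.range (X : E → MvPolynomial E k))) ∧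
    RingTheory.Sequence.IsRegular (MvPolynomial E k ⧸ I) rs ∧
    ringKrullDim (MvPolynomial E k ⧸ I) = (rs.length : WithBot (WithTop ℕ))

/-! ### Ideal-theoretic weak regularity -/

/-- Weak regularity of a list modulo an ideal. -/
def WRg {R : Type} [CommRing R] : Ideal R → List R → Prop
  | _, [] => True
  | I, a :: l => (∀ f, a * f ∈ I → f ∈ I) ∧ WRg (I ⊔ Ideal.span {a}) l

theorem WRg.glue {R : Type} [CommRing R] (x : R) (l : List R) :
    ∀ (I I' : Ideal R), (∀ f, x * f ∈ I ↔ f ∈ I') → WRg I' l →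
      WRg (I ⊔ Ideal.span {x}) l → WRg I l := by
  induction l with
  | nil => intros; trivial
  | cons a l ih =>
    intro I I' hc h1 h2
    obtain ⟨h1a, h1b⟩ := h1
    obtain ⟨h2a, h2b⟩ := h2
    have key : ∀ f, f ∈ I ⊔ Ideal.span {x} ↔ ∃ u, f - x * u ∈ I := by
      intro f
      rw [Submodule.mem_sup]
      constructor
      · rintro ⟨y, hy, z, hz, rfl⟩
        obtain ⟨u, rfl⟩ := Ideal.mem_span_singleton'.1 hz
        exact ⟨u, by convert hy using 1; ring⟩
      · rintro ⟨u, hu⟩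
        exact ⟨_, hu, x * u, Ideal.mul_mem_right _ _ (Ideal.mem_span_singleton_self x), by ring⟩
    have key2 : ∀ (J : Ideal R) f, f ∈ J ⊔ Ideal.span {a} ↔ ∃ u, f - a * u ∈ J := by
      intro J f
      rw [Submodule.mem_sup]
      constructor
      · rintro ⟨y, hy, z, hz, rfl⟩
        obtain ⟨u, rfl⟩ := Ideal.mem_span_singleton'.1 hz
        exact ⟨u, by convert hy using 1; ring⟩
      · rintro ⟨u, hu⟩
        exact ⟨_, hu, a * u, Ideal.mul_mem_right _ _ (Ideal.mem_span_singleton_self a), by ring⟩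
    refine ⟨?_, ih (I ⊔ Ideal.span {a}) (I' ⊔ Ideal.span {a}) ?_ h1b ?_⟩
    · intro f hf
      obtain ⟨u, hu⟩ := (key f).1 (h2a f (Ideal.mem_sup_left hf))
      have h3 : x * (a * u) ∈ I := by
        have := I.sub_mem hf (I.mul_mem_left a hu)
        convert this using 1; ring
      have h4 := (hc u).2 (h1a u ((hc _).1 h3))
      have := I.add_mem hu h4
      simpa using this
    · intro f
      rw [key2, key2]
      constructor
      · rintro ⟨h, hh⟩
        have h5 : a * h ∈ I ⊔ Ideal.span {x} :=
          (key _).2 ⟨f, by have := I.neg_mem hh; convert this using 1; ring⟩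
        obtain ⟨u, hu⟩ := (key h).1 (h2a _ h5)
        refine ⟨u, (hc _).1 ?_⟩
        have := I.add_mem hh (I.mul_mem_left a hu)
        convert this using 1; ring
      · rintro ⟨u, hu⟩
        refine ⟨x * u, ?_⟩
        have := (hc _).2 hu
        convert this using 1; ring
    · rw [sup_right_comm]; exact h2b

theorem WRg.comap {R R' : Type} [CommRing R] [CommRing R'] (φ : R ≃+* R') (l : List R) :
    ∀ I : Ideal R', WRg I (l.map φ) → WRg (I.comap φ) l := by
  induction l with
  | nil => intros; trivial
  | cons a l ih =>
    intro I h
    obtain ⟨h1, h2⟩ := h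
    refine ⟨fun f hf => ?_, ?_⟩
    · rw [Ideal.mem_comap] at hf ⊢
      exact h1 _ (by simpa using hf)
    · have := ih _ h2
      have e : (I ⊔ Ideal.span {φ a}).comap φ = I.comap φ ⊔ Ideal.span {a} := by
        ext f
        rw [Ideal.mem_comap, Submodule.mem_sup, Submodule.mem_sup]
        constructor
        · rintro ⟨y, hy, z, hz, h⟩
          obtain ⟨u, rfl⟩ := Ideal.mem_span_singleton'.1 hz
          refine ⟨φ.symm y, by rw [Ideal.mem_comap]; simpa only [RingEquiv.apply_symm_apply] using hy, φ.symm u * a,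
            Ideal.mul_mem_left _ _ (Ideal.mem_span_singleton_self a), ?_⟩
          apply φ.injective
          simpa using h
        · rintro ⟨y, hy, z, hz, rfl⟩
          obtain ⟨u, rfl⟩ := Ideal.mem_span_singleton'.1 hz
          exact ⟨φ y, hy, φ u * φ a,
            Ideal.mul_mem_left _ _ (Ideal.mem_span_singleton_self _), by simp⟩
      rwa [e] at this

open scoped Pointwise in
theorem WRg.isWeaklyRegular {R : Type} [CommRing R] (l : List R) :
    ∀ I : Ideal R, WRg I l → RingTheory.Sequence.IsWeaklyRegular (R ⧸ I) l := by
  induction l with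
  | nil => intros; simp
  | cons a l ih =>
    intro I h
    obtain ⟨h1, h2⟩ := h
    refine RingTheory.Sequence.IsWeaklyRegular.cons ?_ ?_
    · rw [isSMulRegular_iff_right_eq_zero_of_smul]
      intro x hx
      obtain ⟨f, rfl⟩ := Ideal.Quotient.mk_surjective x
      rw [Ideal.Quotient.eq_zero_iff_mem]
      apply h1
      rw [← Ideal.Quotient.eq_zero_iff_mem, map_mul]
      simpa [Algebra.smul_def] using hx
    · have := ih _ h2
      have e : (a • ⊤ : Submodule R (R ⧸ I)) = Submodule.map (Submodule.mkQ I) (Ideal.span {a}) := by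
        ext y
        rw [Submodule.mem_smul_pointwise_iff_exists, Submodule.mem_map]
        constructor
        · rintro ⟨b, -, rfl⟩
          obtain ⟨f, rfl⟩ := Ideal.Quotient.mk_surjective b
          exact ⟨a * f, Ideal.mul_mem_right _ _ (Ideal.mem_span_singleton_self a), rfl⟩
        · rintro ⟨z, hz, rfl⟩
          obtain ⟨u, rfl⟩ := Ideal.mem_span_singleton'.1 hz
          exact ⟨Ideal.Quotient.mk I u, trivial, by rw [mul_comm]; rfl⟩
      have E1 : QuotSMulTop a (R ⧸ I) ≃ₗ[R] (R ⧸ (I ⊔ Ideal.span {a})) :=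
        (Submodule.quotEquivOfEq _ _ e).trans
          (Submodule.quotientQuotientEquivQuotientSup I (Ideal.span {a}))
      exact (E1.isWeaklyRegular_congr l).2 this

/-! ### Decomposable set systems -/

/-- A set system that can be decomposed by successive exchange elements. -/
inductive VDec {E : Type} [DecidableEq E] : Set (Finset E) → Prop
  | empty : VDec ∅
  | single (T : Finset E) : VDec {T}
  | step (F : Set (Finset E)) (e : E) (h1 : VDec {T ∈ F | e ∈ T}) (h2 : VDec {T ∈ F | e ∉ T})
      (hex : ∀ T ∈ F, e ∉ T → ∃ e' ∈ T, insert e (T.erase e') ∈ F) : VDec F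

/-- Shelling condition in terms of list splittings. -/
def ShellL {E : Type} [DecidableEq E] (l : List (Finset E)) : Prop :=
  ∀ (a : List (Finset E)) (F : Finset E) (b : List (Finset E)), l = a ++ F :: b → ∀ F' ∈ a, ∃ F'' ∈ a, ∃ x ∈ F,
    F' ∩ F ⊆ F'' ∩ F ∧ F'' ∩ F = F.erase x

theorem VDec.shell {E : Type} [Fintype E] [DecidableEq E] {F : Set (Finset E)} (h : VDec F) :
    ∃ l : List (Finset E), l.Nodup ∧ (∀ τ : Finset E, τᶜ ∈ F ↔ τ ∈ l) ∧ ShellL l := by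
  induction h with
  | empty => exact ⟨[], by simp, by simp, by intro a F b h; simp at h⟩
  | single T =>
    refine ⟨[Tᶜ], by simp, fun τ => ?_, ?_⟩
    · simp only [Set.mem_singleton_iff, List.mem_singleton]
      exact compl_eq_comm.trans eq_comm
    · intro a F b h F' hF'
      rcases a with _ | ⟨a, a'⟩
      · simp at hF'
      · simp at h
  | step F e h1 h2 hex ih1 ih2 =>
    obtain ⟨l1, n1, m1, s1⟩ := ih1
    obtain ⟨l2, n2, m2, s2⟩ := ih2
    simp only [Set.mem_ofPred_eq, mem_compl, not_not] at m1 m2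
    refine ⟨l1 ++ l2, ?_, ?_, ?_⟩
    · rw [List.nodup_append]
      refine ⟨n1, n2, ?_⟩
      rintro a ha b hb rfl
      exact ((m1 a).2 ha).2 ((m2 a).2 hb).2
    · intro τ
      rw [List.mem_append, ← m1, ← m2]
      tauto
    · have main : ∀ a T b, l2 = a ++ T :: b → ∀ F' ∈ l1 ++ a, ∃ F'' ∈ l1 ++ a, ∃ x ∈ T,
          F' ∩ T ⊆ F'' ∩ T ∧ F'' ∩ T = T.erase x := by
        intro a T b h F' hF'
        rw [List.mem_append] at hF'
        rcases hF' with hF' | hF'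
        · have hT : T ∈ l2 := by rw [h]; simp
          have hT' := (m2 T).2 hT
          obtain ⟨e', he', hm⟩ := hex _ hT'.1 (by simpa using hT'.2)
          have hF'e := ((m1 F').2 hF').2
          rw [mem_compl] at he'
          have hne : e' ≠ e := fun h => he' (h ▸ hT'.2)
          refine ⟨(insert e (Tᶜ.erase e'))ᶜ, ?_, e, hT'.2, ?_, ?_⟩
          · rw [List.mem_append]; left
            rw [← m1]
            exact ⟨by simpa using hm, by simp⟩
          · intro y hy
            simp only [mem_inter, mem_compl, mem_insert, mem_erase] at hy ⊢
            have : y ≠ e := fun h => hF'e (h ▸ hy.1)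
            tauto
          · ext y
            simp only [mem_inter, mem_compl, mem_insert, mem_erase]
            by_cases hy : y = e'
            · subst hy; tauto
            · tauto
        · obtain ⟨F'', hF'', x, hx, h3⟩ := s2 a T b h F' hF'
          exact ⟨F'', by simp [hF''], x, hx, h3⟩
      intro a T b h F' hF'
      rw [List.append_eq_append_iff] at h
      rcases h with ⟨a', rfl, h⟩ | ⟨c, h, h'⟩
      · exact main a' T b h F' hF'
      · rcases c with _ | ⟨c, c'⟩
        · simp only [List.nil_append, List.append_nil] at h h'
          subst h
          simpa using main [] T b (by simpa using h'.symm) F' (by simpa using hF')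
        · simp only [List.cons_append, List.cons.injEq] at h'
          obtain ⟨rfl, h'⟩ := h'
          exact s1 a T c' h F' hF'

/-- The intersection of the monomial primes of a set system. -/
def sysIdeal {E : Type} (k : Type) [Field k] (F : Set (Finset E)) : Ideal (MvPolynomial E k) :=
  ⨅ T ∈ F, Ideal.span (X '' (T : Set E))

theorem mem_sysIdeal {E k : Type} [Field k] {F : Set (Finset E)} {p : MvPolynomial E k} :
    p ∈ sysIdeal k F ↔ ∀ m ∈ p.support, ∀ T ∈ F, ∃ e ∈ T, m e ≠ 0 := by
  simp only [sysIdeal, Submodule.mem_iInf, mem_ideal_span_X_image]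
  constructor
  · intro h m hm T hT
    simpa using h T hT m hm
  · intro h T hT m hm
    simpa using h m hm T hT

theorem mem_supp_X_mul {E k : Type} [Field k] {p : MvPolynomial E k} {e : E} {m : E →₀ ℕ} :
    m ∈ (X e * p).support ↔ ∃ m' ∈ p.support, m = m' + Finsupp.single e 1 := by
  rw [support_X_mul, Finset.mem_map]
  simp [add_comm, eq_comm]

theorem WRg_vars {E k : Type} [Field k] (L : List E) : ∀ U : Set E, L.Nodup → (∀ e ∈ L, e ∉ U) →
    WRg (Ideal.span (X '' U : Set (MvPolynomial E k))) (L.map X) := by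
  induction L with
  | nil => intros; trivial
  | cons a L ih =>
    intro U hn hU
    rw [List.nodup_cons] at hn
    refine ⟨fun f hf => ?_, ?_⟩
    · rw [mem_ideal_span_X_image] at hf ⊢
      intro m hm
      obtain ⟨i, hi, hmi⟩ := hf _ (mem_supp_X_mul.2 ⟨m, hm, rfl⟩)
      refine ⟨i, hi, ?_⟩
      have : a ≠ i := fun h => hU a (by simp) (h ▸ hi)
      simpa [Finsupp.single_apply, this] using hmi
    · have := ih (insert a U) hn.2 (by
        intro e he h
        rcases h with rfl | h
        · exact hn.1 he
        · exact hU e (by simp [he]) h)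
      rw [Set.image_insert_eq, Ideal.span_insert, sup_comm] at this
      exact this

/-- Transversals of the fibres of `h`. -/
def IsTransv {E V : Type} (h : E → V) (T : Finset E) : Prop :=
  (∀ e ∈ T, ∀ e' ∈ T, h e = h e' → e = e') ∧ ∀ e, ∃ e' ∈ T, h e' = h e

theorem WRg_single {E V k : Type} [Field k] [Fintype E] [DecidableEq E] (h : E → V) (T0 T : Finset E)
    (h0 : IsTransv h T0) (hT : IsTransv h T) (ρ : E → E) (hρ : ∀ e, ρ e ∈ T0 ∧ h (ρ e) = h e)
    (L : List E) (hL : L.Nodup) (hL0 : ∀ e ∈ L, e ∉ T0) :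
    WRg (Ideal.span (X '' (T : Set E) : Set (MvPolynomial E k)))
      (L.map fun e => X e - X (ρ e)) := by
  choose γ hγ using hT.2
  have hρ0 : ∀ r ∈ T0, ρ r = r := fun r hr => h0.1 _ (hρ r).1 _ hr (hρ r).2
  have hγT : ∀ r ∈ T, γ r = r := fun r hr => hT.1 _ (hγ r).1 _ hr (hγ r).2
  let tr : E → MvPolynomial E k := fun r => if r ∈ T then X r else X r - X (γ r)
  let τ : MvPolynomial E k →ₐ[k] MvPolynomial E k :=
    aeval fun e => if e ∈ T0 then tr e else X e + tr (ρ e)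
  let σ : MvPolynomial E k →ₐ[k] MvPolynomial E k :=
    aeval fun e => if e ∈ T0 then X (γ e) else X e - X (ρ e)
  have τ0 : ∀ r ∈ T0, τ (X r) = tr r := fun r hr => by simp [τ, hr]
  have τ1 : ∀ r ∉ T0, τ (X r) = X r + tr (ρ r) := fun r hr => by simp [τ, hr]
  have σ0 : ∀ r ∈ T0, σ (X r) = X (γ r) := fun r hr => by simp [σ, hr]
  have σ1 : ∀ r ∉ T0, σ (X r) = X r - X (ρ r) := fun r hr => by simp [σ, hr]
  have γn : ∀ r ∈ T0, r ∉ T → γ r ∉ T0 ∧ ρ (γ r) = r := by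
    intro r hr hrT
    refine ⟨fun hh => ?_, h0.1 _ (hρ _).1 _ hr ((hρ _).2.trans (hγ r).2)⟩
    have := h0.1 _ hh _ hr (hγ r).2
    exact hrT (this ▸ (hγ r).1)
  have τγ : ∀ r ∈ T0, τ (X (γ r)) = X r := by
    intro r hr
    by_cases hrT : r ∈ T
    · rw [hγT r hrT, τ0 r hr]; simp [tr, hrT]
    · rw [τ1 _ (γn r hr hrT).1, (γn r hr hrT).2]; simp [tr, hrT]
  have c1 : ∀ e, τ (σ (X e)) = X e := by
    intro e
    by_cases he : e ∈ T0
    · rw [σ0 e he, τγ e he]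
    · rw [σ1 e he, map_sub, τ1 e he, τ0 _ (hρ e).1]; ring
  have σtr : ∀ r ∈ T0, σ (tr r) = X r := by
    intro r hr
    by_cases hrT : r ∈ T
    · simp only [tr, hrT, if_true]; rw [σ0 r hr, hγT r hrT]
    · simp only [tr, hrT, if_false]
      rw [map_sub, σ0 r hr, σ1 _ (γn r hr hrT).1, (γn r hr hrT).2]; ring
  have c2 : ∀ e, σ (τ (X e)) = X e := by
    intro e
    by_cases he : e ∈ T0
    · rw [τ0 e he, σtr e he]
    · rw [τ1 e he, map_add, σ1 e he, σtr _ (hρ e).1]; ring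
  let φ : MvPolynomial E k ≃ₐ[k] MvPolynomial E k :=
    AlgEquiv.ofAlgHom τ σ (by ext1 e; simpa using c1 e) (by ext1 e; simpa using c2 e)
  have hφ : ∀ p, φ p = τ p := fun p => rfl
  have hφs : ∀ p, φ.symm p = σ p := fun p => rfl
  have base := WRg_vars (k := k) L (T0 : Set E) hL (by simpa using hL0)
  have hmap : (L.map fun e => (X e - X (ρ e) : MvPolynomial E k)).map φ.toRingEquiv = L.map X := by
    rw [List.map_map]
    apply List.map_congr_left
    intro e he
    change τ (X e - X (ρ e)) = X e
    rw [← σ1 e (hL0 e he), c1]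
  rw [← hmap] at base
  have := WRg.comap φ.toRingEquiv _ _ base
  convert this using 1
  apply le_antisymm
  · rw [Ideal.span_le]
    rintro _ ⟨t, ht, rfl⟩
    rw [SetLike.mem_coe, Ideal.mem_comap]
    change τ (X t) ∈ _
    have : γ (ρ t) = t := hT.1 _ (hγ _).1 _ ht ((hγ _).2.trans (hρ t).2)
    rw [← this, τγ _ (hρ t).1]
    exact Ideal.subset_span ⟨_, (hρ t).1, rfl⟩
  · intro p hp
    rw [Ideal.mem_comap] at hp
    have h3 : Ideal.span (X '' (T0 : Set E) : Set (MvPolynomial E k)) ≤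
        (Ideal.span (X '' (T : Set E) : Set (MvPolynomial E k))).comap σ := by
      rw [Ideal.span_le]
      rintro _ ⟨t, ht, rfl⟩
      rw [SetLike.mem_coe, Ideal.mem_comap, σ0 t ht]
      exact Ideal.subset_span ⟨_, (hγ t).1, rfl⟩
    have h4 := h3 hp
    rw [Ideal.mem_comap] at h4
    have : σ (τ p) = p := φ.symm_apply_apply p
    change σ (τ p) ∈ _ at h4
    rwa [this] at h4

theorem VDec.wr {E V k : Type} [Field k] [Fintype E] [DecidableEq E] (h : E → V) (T0 : Finset E)
    (h0 : IsTransv h T0) (ρ : E → E) (hρ : ∀ e, ρ e ∈ T0 ∧ h (ρ e) = h e)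
    (L : List E) (hL : L.Nodup) (hL0 : ∀ e ∈ L, e ∉ T0) {F : Set (Finset E)} (hF : VDec F) :
    (∀ T ∈ F, IsTransv h T) → WRg (sysIdeal k F) (L.map fun e => X e - X (ρ e)) := by
  induction hF with
  | empty =>
    intro _
    have : ∀ (l : List (MvPolynomial E k)) I, I = ⊤ → WRg I l := by
      intro l
      induction l with
      | nil => intros; trivial
      | cons a l ih => rintro I rfl; exact ⟨fun f _ => trivial, ih _ (by simp)⟩
    exact this _ _ (by simp [sysIdeal])
  | single T =>
    intro hT
    have := WRg_single (k := k) h T0 T h0 (hT T rfl) ρ hρ L hL hL0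
    simpa [sysIdeal] using this
  | step F e h1 h2 hex ih1 ih2 =>
    intro hT
    refine WRg.glue (X e) _ _ _ ?_ (ih2 fun T hh => hT T hh.1) ?_
    · intro f
      rw [mem_sysIdeal, mem_sysIdeal]
      constructor
      · intro H m hm T hTF
        obtain ⟨i, hi, hmi⟩ := H _ (mem_supp_X_mul.2 ⟨m, hm, rfl⟩) T hTF.1
        refine ⟨i, hi, ?_⟩
        have : e ≠ i := fun h => hTF.2 (h ▸ hi)
        simpa [Finsupp.single_apply, this] using hmi
      · intro H m hm T hTF
        obtain ⟨m', hm', rfl⟩ := mem_supp_X_mul.1 hm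
        by_cases he : e ∈ T
        · exact ⟨e, he, by simp⟩
        · obtain ⟨i, hi, hmi⟩ := H m' hm' T ⟨hTF, he⟩
          exact ⟨i, hi, by simp [hmi]⟩
    · have : sysIdeal k F ⊔ Ideal.span {X e} = sysIdeal k {T ∈ F | e ∈ T} := by
        apply le_antisymm
        · rw [sup_le_iff, Ideal.span_singleton_le_iff_mem]
          constructor
          · intro p hp
            rw [mem_sysIdeal] at hp ⊢
            exact fun m hm T hTF => hp m hm T hTF.1
          · rw [mem_sysIdeal]
            intro m hm T hTF
            rw [support_X, Finset.mem_singleton] at hm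
            exact ⟨e, hTF.2, by simp [hm]⟩
        · intro p hp
          rw [mem_sysIdeal] at hp
          rw [p.as_sum]
          refine Ideal.sum_mem _ fun m hm => ?_
          by_cases hme : m e = 0
          · apply Ideal.mem_sup_left
            rw [mem_sysIdeal]
            intro m' hm' T hTF
            have := support_monomial_subset hm'
            rw [Finset.mem_singleton] at this
            subst this
            by_cases he : e ∈ T
            · exact hp m' hm T ⟨hTF, he⟩
            · obtain ⟨e', he', hs⟩ := hex T hTF he
              obtain ⟨i, hi, hmi⟩ := hp m' hm _ ⟨hs, by simp⟩
              refine ⟨i, ?_, hmi⟩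
              rw [mem_insert] at hi
              rcases hi with rfl | hi
              · exact absurd hme hmi
              · exact mem_of_mem_erase hi
          · apply Ideal.mem_sup_right
            rw [Ideal.mem_span_singleton, X_dvd_monomial]
            exact Or.inr hme
      rw [this]
      exact ih1 fun T hh => hT T hh.1

/-! ### Arborescences -/

namespace DirGraph

variable {V E : Type} (G : DirGraph V E)

/-- Spanning arborescences rooted at `q`. -/
def Arb (q : V) (T : Finset E) : Prop :=
  (∀ e ∈ T, ∀ e' ∈ T, G.head e = G.head e' → e = e') ∧ ∀ v, G.ReachIn T q v

/-- Partial arborescences rooted at `q`. -/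
def PArb (q : V) (T : Finset E) : Prop :=
  (∀ e ∈ T, ∀ e' ∈ T, G.head e = G.head e' → e = e') ∧ ∀ e ∈ T, G.ReachIn T q (G.tail e)

variable {G}

theorem ReachIn.step {T : Finset E} {q : V} {e : E} (h : G.ReachIn T q (G.tail e)) (he : e ∈ T) :
    G.ReachIn T q (G.head e) :=
  Relation.ReflTransGen.tail h ⟨e, he, rfl, rfl⟩

theorem ReachIn.closed {T : Finset E} {q v : V} (h : G.ReachIn T q v) (P : V → Prop) (h0 : P q)
    (hs : ∀ e ∈ T, P (G.tail e) → P (G.head e)) : P v := by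
  induction h with
  | refl => exact h0
  | tail _ h2 ih =>
    obtain ⟨e, he, rfl, rfl⟩ := h2
    exact hs e he ih

theorem ReachIn.mono {T T' : Finset E} {q v : V} (h : G.ReachIn T q v) (hT : T ⊆ T') :
    G.ReachIn T' q v :=
  h.closed (fun v => G.ReachIn T' q v) Relation.ReflTransGen.refl
    fun _ he hr => hr.step (hT he)

theorem ReachIn.last {T : Finset E} {q v : V} (h : G.ReachIn T q v) (hv : v ≠ q) :
    ∃ e ∈ T, G.head e = v := by
  have := h.closed (fun v => v = q ∨ ∃ e ∈ T, G.head e = v) (Or.inl rfl)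
    fun e he _ => Or.inr ⟨e, he, rfl⟩
  exact this.resolve_left hv

theorem PArb.insert [DecidableEq E] {q : V} {C : Finset E} {e : E} (hC : G.PArb q C)
    (ht : G.ReachIn C q (G.tail e)) (hh : ¬ G.ReachIn C q (G.head e)) :
    G.PArb q (insert e C) := by
  have key : ∀ f ∈ C, G.head f ≠ G.head e := fun f hf h => hh (h ▸ (hC.2 f hf).step hf)
  refine ⟨?_, ?_⟩
  · intro a ha b hb hab
    rw [mem_insert] at ha hb
    rcases ha with rfl | ha <;> rcases hb with rfl | hb
    · rfl
    · exact absurd hab.symm (key b hb)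
    · exact absurd hab (key a ha)
    · exact hC.1 a ha b hb hab
  · intro a ha
    rw [mem_insert] at ha
    rcases ha with rfl | ha
    · exact ht.mono (subset_insert _ _)
    · exact (hC.2 a ha).mono (subset_insert _ _)

theorem exists_arb [DecidableEq E] {q : V} (R : Finset E) (hR : ∀ v, G.ReachIn R q v) :
    ∃ T ⊆ R, G.Arb q T := by
  classical
  obtain ⟨C, hC, hmax⟩ := (R.powerset.filter (fun C => G.PArb q C)).exists_max_image Finset.card
    ⟨∅, mem_filter.2 ⟨by simp, by simp [PArb]⟩⟩
  simp only [mem_filter, mem_powerset] at hC hmax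
  refine ⟨C, hC.1, hC.2.1, fun v => ?_⟩
  refine (hR v).closed (fun v => G.ReachIn C q v) Relation.ReflTransGen.refl ?_
  intro e he ht
  by_contra hh
  have heC : e ∉ C := fun h => hh (ht.step h)
  have := hmax (Insert.insert e C) ⟨insert_subset he hC.1, hC.2.insert ht hh⟩
  rw [card_insert_of_notMem heC] at this
  omega

theorem vdec_arb_aux [Fintype E] [DecidableEq E] {q : V} (hq : ∀ e, G.head e ≠ q) (n : ℕ) :
    ∀ C D : Finset E, G.PArb q C → ((C ∪ D)ᶜ).card ≤ n →
      VDec {T | G.Arb q T ∧ C ⊆ T ∧ Disjoint T D} := by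
  induction n with
  | zero =>
    intro C D hC hn
    exact term C D hC (fun e heD ht => by
      have : e ∈ C ∪ D := by
        by_contra h
        have : e ∈ (C ∪ D)ᶜ := mem_compl.2 h
        have := card_pos.2 ⟨e, this⟩
        omega
      rcases mem_union.1 this with h | h
      · exact ht.step h
      · exact absurd h heD)
  | succ n ih =>
    intro C D hC hn
    by_cases hterm : ∀ e, e ∉ D → G.ReachIn C q (G.tail e) → G.ReachIn C q (G.head e)
    · exact term C D hC hterm
    push Not at hterm
    obtain ⟨e, heD, ht, hh⟩ := hterm
    have heC : e ∉ C := fun h => hh (ht.step h)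
    have hmem : e ∈ (C ∪ D)ᶜ := by simp [heC, heD]
    refine VDec.step _ e ?_ ?_ ?_
    · have := ih (Insert.insert e C) D (hC.insert ht hh) (by
        have h1 : (Insert.insert e C ∪ D)ᶜ = (C ∪ D)ᶜ.erase e := by ext; simp
        rw [h1, card_erase_of_mem hmem]; omega)
      convert this using 1
      ext T
      simp only [Set.mem_ofPred_eq, insert_subset_iff]
      tauto
    · have := ih C (Insert.insert e D) hC (by
        have h1 : (C ∪ Insert.insert e D)ᶜ = (C ∪ D)ᶜ.erase e := by ext; simp
        rw [h1, card_erase_of_mem hmem]; omega)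
      convert this using 1
      ext T
      simp only [Set.mem_ofPred_eq, disjoint_insert_right]
      tauto
    · rintro T ⟨hT, hCT, hTD⟩ heT
      have hhq : G.head e ≠ q := hq e
      obtain ⟨e', he', hhe'⟩ := (hT.2 (G.head e)).last hhq
      have he'C : e' ∉ C := fun h => hh (hhe' ▸ (hC.2 e' h).step h)
      have hCT' : C ⊆ Insert.insert e (T.erase e') := by
        intro f hf
        exact mem_insert_of_mem (mem_erase.2 ⟨fun h => he'C (h ▸ hf), hCT hf⟩)
      refine ⟨e', he', ⟨?_, ?_⟩, hCT', ?_⟩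
      · intro a ha b hb hab
        simp only [mem_insert, mem_erase] at ha hb
        rcases ha with rfl | ha <;> rcases hb with rfl | hb
        · rfl
        · exact absurd (hT.1 b hb.2 e' he' (hab.symm.trans hhe'.symm)) hb.1
        · exact absurd (hT.1 a ha.2 e' he' (hab.trans hhe'.symm)) ha.1
        · exact hT.1 a ha.2 b hb.2 hab
      · intro v
        refine (hT.2 v).closed (fun v => G.ReachIn (Insert.insert e (T.erase e')) q v)
          Relation.ReflTransGen.refl ?_
        intro f hf hr
        by_cases hfe : f = e'
        · rw [hfe, hhe']
          exact (ht.mono hCT').step (mem_insert_self _ _)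
        · exact hr.step (mem_insert_of_mem (mem_erase.2 ⟨hfe, hf⟩))
      · rw [disjoint_insert_left]
        exact ⟨heD, hTD.mono_left (erase_subset _ _)⟩
where
  term (C D : Finset E) (hC : G.PArb q C)
      (ht : ∀ e, e ∉ D → G.ReachIn C q (G.tail e) → G.ReachIn C q (G.head e)) :
      VDec {T | G.Arb q T ∧ C ⊆ T ∧ Disjoint T D} := by
    have : {T | G.Arb q T ∧ C ⊆ T ∧ Disjoint T D} ⊆ {C} := by
      rintro T ⟨hT, hCT, hTD⟩
      have hr : ∀ v, G.ReachIn C q v := fun v =>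
        (hT.2 v).closed (fun v => G.ReachIn C q v) Relation.ReflTransGen.refl
          fun e he h => ht e (Finset.disjoint_left.1 hTD he) h
      refine (subset_antisymm hCT fun f hf => ?_).symm
      obtain ⟨f', hf', hh⟩ := (hr (G.head f)).last (hq f)
      rw [← hT.1 f' (hCT hf') f hf hh]
      exact hf'
    rcases Set.subset_singleton_iff_eq.1 this with h | h <;> rw [h]
    · exact VDec.empty
    · exact VDec.single C

theorem vdec_arb [Fintype E] [DecidableEq E] {q : V} (hq : ∀ e, G.head e ≠ q) :
    VDec {T | G.Arb q T} := by
  have := vdec_arb_aux hq _ ∅ ∅ (by simp [PArb]) le_rfl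
  simpa using this

theorem Arb.transv {q : V} (hq : ∀ e, G.head e ≠ q) {T : Finset E} (hT : G.Arb q T) :
    IsTransv G.head T :=
  ⟨hT.1, fun e => (hT.2 (G.head e)).last (hq e)⟩

theorem Arb.card_eq [Fintype V] {q : V} (hq : ∀ e, G.head e ≠ q) {T : Finset E}
    (hT : G.Arb q T) : T.card = Fintype.card V - 1 := by
  classical
  have : T.image G.head = univ.erase q := by
    ext v
    simp only [mem_image, mem_erase, mem_univ, and_true]
    constructor
    · rintro ⟨e, _, rfl⟩; exact hq e
    · exact fun hv => (hT.2 v).last hv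
  rw [← card_image_of_injOn (f := G.head) (s := T) (fun a ha b hb h => hT.1 a ha b hb h), this,
    card_erase_of_mem (mem_univ q), card_univ]

theorem cutIdeal_eq [Fintype V] [Fintype E] [DecidableEq E] (k : Type) [Field k] {q : V} :
    G.cutIdeal k q = sysIdeal k {T | G.Arb q T} := by
  classical
  apply le_antisymm
  · rw [cutIdeal, Ideal.span_le]
    rintro _ ⟨A, ⟨a, ha⟩, hqA, rfl⟩
    simp only [sysIdeal, SetLike.mem_coe, Submodule.mem_iInf]
    intro T hT
    have : ∃ e ∈ T, G.head e ∈ A ∧ G.tail e ∉ A := by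
      by_contra hcon
      push Not at hcon
      exact (hT.2 a).closed (fun v => v ∉ A) hqA
        (fun e he h h' => h (hcon e he h')) ha
    obtain ⟨e, he, h⟩ := this
    refine Ideal.mem_of_dvd _ (Finset.dvd_prod_of_mem X (a := e) ?_)
      (Ideal.subset_span ⟨e, he, rfl⟩)
    simpa using h
  · intro p hp
    rw [mem_sysIdeal] at hp
    rw [p.as_sum]
    refine Ideal.sum_mem _ fun m hm => ?_
    have hR : ¬ ∀ v, G.ReachIn (m.supportᶜ) q v := by
      intro h
      obtain ⟨T, hTR, hT⟩ := exists_arb _ h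
      obtain ⟨e, he, hme⟩ := hp m hm T hT
      have := hTR he
      simp at this
      exact hme this
    push Not at hR
    obtain ⟨v, hv⟩ := hR
    refine Ideal.mem_of_dvd _ ?_ (Ideal.subset_span
      ⟨univ.filter fun v => ¬ G.ReachIn (m.supportᶜ) q v, ⟨v, by simpa using hv⟩,
        fun h => (mem_filter.1 h).2 Relation.ReflTransGen.refl, rfl⟩)
    rw [monomial_eq]
    apply Dvd.dvd.mul_left
    rw [Finsupp.prod]
    refine (Finset.prod_dvd_prod_of_subset _ m.support _ ?_).trans
      (Finset.prod_dvd_prod_of_dvd _ _ ?_)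
    · intro e he
      simp only [mem_filter, mem_univ, true_and, not_not] at he
      by_contra hes
      exact he.1 (he.2.step (mem_compl.2 hes))
    · intro e he
      exact dvd_pow_self _ (Finsupp.mem_support_iff.1 he)

end DirGraph

theorem isSRFace_sys {E k : Type} [Field k] {F : Set (Finset E)} {τ : Finset E} :
    IsSRFace (sysIdeal k F) τ ↔ ∃ T ∈ F, Disjoint T τ := by
  classical
  rw [IsSRFace, ← not_iff_not, not_not]
  push Not
  simp only [sysIdeal, Submodule.mem_iInf]
  refine forall₂_congr fun T hT => ?_
  rw [Finset.not_disjoint_iff]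
  constructor
  · intro h
    by_contra hcon
    push Not at hcon
    have h2 : Ideal.span (X '' (T : Set E) : Set (MvPolynomial E k)) ≤
        RingHom.ker (eval (fun e => if e ∈ T then (0 : k) else 1)) := by
      rw [Ideal.span_le]
      rintro _ ⟨t, ht, rfl⟩
      have : t ∈ T := ht
      simp [RingHom.mem_ker, this]
    have h3 := h2 h
    rw [RingHom.mem_ker, map_prod, Finset.prod_eq_one] at h3
    · exact one_ne_zero h3
    · intro e he
      have : e ∉ T := fun h => hcon e h he
      simp [this]
  · rintro ⟨e, he, heτ⟩
    exact Ideal.mem_of_dvd _ (Finset.dvd_prod_of_mem X heτ) (Ideal.subset_span ⟨e, he, rfl⟩)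

theorem isSRFacet_sys {E k : Type} [Field k] [Fintype E] [DecidableEq E] {F : Set (Finset E)}
    {n : ℕ} (hn : ∀ T ∈ F, T.card = n) {τ : Finset E} :
    IsSRFacet (sysIdeal k F) τ ↔ τᶜ ∈ F := by
  simp only [IsSRFacet, isSRFace_sys]
  constructor
  · rintro ⟨⟨T, hT, hd⟩, hmax⟩
    have h1 : τ ⊆ Tᶜ := fun x hx => mem_compl.2 fun h => Finset.disjoint_left.1 hd h hx
    rcases h1.eq_or_ssubset with rfl | h1
    · simpa using hT
    · exact absurd ⟨T, hT, disjoint_compl_right⟩ (hmax _ h1)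
  · intro h
    refine ⟨⟨_, h, disjoint_compl_left⟩, ?_⟩
    rintro τ' hτ ⟨T, hT, hd⟩
    have h1 : T ⊆ τ'ᶜ := fun x hx => mem_compl.2 fun h => Finset.disjoint_left.1 hd hx h
    have h2 : τ'ᶜ ⊂ τᶜ := by simpa using hτ
    have := card_le_card h1
    have := card_lt_card h2
    rw [hn _ h] at this
    rw [hn _ hT] at *
    omega

theorem dim_sys {E k : Type} [Field k] [Fintype E] [DecidableEq E] {F : Set (Finset E)}
    {n : ℕ} (hn : ∀ T ∈ F, T.card = n) (T0 : Finset E) (h0 : T0 ∈ F) :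
    ringKrullDim (MvPolynomial E k ⧸ sysIdeal k F) = ((Fintype.card E - n : ℕ) : WithBot (WithTop ℕ)) := by
  have dimT : ∀ T ∈ F, ringKrullDim (MvPolynomial {e // e ∉ T} k)
      = ((Fintype.card E - n : ℕ) : WithBot (WithTop ℕ)) := by
    intro T hT
    rw [MvPolynomial.ringKrullDim_of_isNoetherianRing, ringKrullDim_eq_zero_of_field, zero_add]
    have : Nat.card {e // e ∉ T} = Fintype.card E - n := by
      rw [Nat.card_eq_fintype_card, Fintype.card_subtype_compl, ← hn T hT]
      simp
    rw [this]
    rfl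
  apply le_antisymm
  · rw [ringKrullDim_quotient]
    refine iSup_le fun p => ?_
    have hp : sysIdeal k F ≤ p.head.1.asIdeal := p.head.2
    have hT : ∃ T ∈ F, ∀ e ∈ T, (X e : MvPolynomial E k) ∈ p.head.1.asIdeal := by
      by_contra hcon
      push Not at hcon
      have hc : ∀ T : Finset E, ∃ f : MvPolynomial E k, T ∈ F →
          f ∈ Ideal.span (X '' (T : Set E) : Set (MvPolynomial E k)) ∧ f ∉ p.head.1.asIdeal := by
        intro T
        by_cases hT : T ∈ F
        · obtain ⟨e, he, h⟩ := hcon T hT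
          exact ⟨X e, fun _ => ⟨Ideal.subset_span ⟨e, he, rfl⟩, h⟩⟩
        · exact ⟨0, fun h => absurd h hT⟩
      choose c hc using hc
      have h1 : (∏ T ∈ (Set.toFinite F).toFinset, c T) ∈ sysIdeal k F := by
        simp only [sysIdeal, Submodule.mem_iInf]
        intro T hT
        exact Ideal.mem_of_dvd _ (Finset.dvd_prod_of_mem c
          (a := T) ((Set.toFinite F).mem_toFinset.2 hT)) (hc T hT).1
      have hpr : p.head.1.asIdeal.IsPrime := p.head.1.isPrime
      obtain ⟨T, hT, h⟩ := hpr.prod_mem_iff.1 (hp h1)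
      exact (hc T ((Set.toFinite F).mem_toFinset.1 hT)).2 h
    obtain ⟨T, hT, hX⟩ := hT
    have hle : Ideal.span (X '' (T : Set E) : Set (MvPolynomial E k)) ≤ p.head.1.asIdeal := by
      rw [Ideal.span_le]; rintro _ ⟨t, ht, rfl⟩; exact hX t ht
    have hall : ∀ i, (p i).1 ∈ PrimeSpectrum.zeroLocus
        (Ideal.span (X '' (T : Set E) : Set (MvPolynomial E k)) : Set (MvPolynomial E k)) := by
      intro i
      have : p.head ≤ p i := p.head_le i
      have h2 : p.head.1.asIdeal ≤ (p i).1.asIdeal := this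
      exact hle.trans h2
    let p' : LTSeries (PrimeSpectrum.zeroLocus
        (Ideal.span (X '' (T : Set E) : Set (MvPolynomial E k)) : Set (MvPolynomial E k))) :=
      ⟨p.length, fun i => ⟨(p i).1, hall i⟩, fun i => p.step i⟩
    have h3 : ((p.length : ℕ) : WithBot (WithTop ℕ)) ≤
        ringKrullDim (MvPolynomial E k ⧸ Ideal.span (X '' (T : Set E) : Set (MvPolynomial E k))) := by
      rw [ringKrullDim_quotient]
      exact le_iSup (fun q : LTSeries (PrimeSpectrum.zeroLocus
        (Ideal.span (X '' (T : Set E) : Set (MvPolynomial E k)) : Set (MvPolynomial E k))) =>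
          ((q.length : ℕ) : WithBot (WithTop ℕ))) p'
    refine h3.trans ?_
    rw [← dimT T hT]
    refine ringKrullDim_le_of_surjective
      ((Ideal.Quotient.mk (Ideal.span (X '' (T : Set E) : Set (MvPolynomial E k)))).comp
        (rename (R := k) (fun e : {e // e ∉ T} => e.1)).toRingHom) ?_
    intro y
    obtain ⟨f, rfl⟩ := Ideal.Quotient.mk_surjective y
    induction f using MvPolynomial.induction_on with
    | C a => exact ⟨C a, by simp⟩
    | add f g hf hg =>
      obtain ⟨a, ha⟩ := hf
      obtain ⟨b, hb⟩ := hg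
      exact ⟨a + b, by rw [map_add, ha, hb, map_add]⟩
    | mul_X f e hf =>
      obtain ⟨a, ha⟩ := hf
      by_cases he : e ∈ T
      · refine ⟨0, ?_⟩
        rw [map_zero, eq_comm, Ideal.Quotient.eq_zero_iff_mem]
        exact Ideal.mul_mem_left _ _ (Ideal.subset_span ⟨e, he, rfl⟩)
      · refine ⟨a * X ⟨e, he⟩, ?_⟩
        rw [map_mul, ha, map_mul]
        simp
  · rw [← dimT T0 h0]
    let φ : MvPolynomial E k →ₐ[k] MvPolynomial {e // e ∉ T0} k :=
      aeval fun e => if h : e ∈ T0 then 0 else X ⟨e, h⟩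
    have hφ : ∀ a ∈ sysIdeal k F, φ a = 0 := by
      intro a ha
      have h1 : sysIdeal k F ≤ Ideal.span (X '' (T0 : Set E)) := iInf₂_le T0 h0
      have h2 : Ideal.span (X '' (T0 : Set E) : Set (MvPolynomial E k)) ≤ RingHom.ker φ := by
        rw [Ideal.span_le]
        rintro _ ⟨t, ht, rfl⟩
        have : t ∈ T0 := ht
        simp [RingHom.mem_ker, φ, this]
      exact h2 (h1 ha)
    refine ringKrullDim_le_of_surjective (Ideal.Quotient.lift _ φ.toRingHom hφ) ?_
    intro y
    refine ⟨Ideal.Quotient.mk _ (rename (fun e : {e // e ∉ T0} => e.1) y), ?_⟩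
    rw [Ideal.Quotient.lift_mk]
    change φ _ = _
    rw [aeval_rename]
    have : ((fun e => if h : e ∈ T0 then 0 else X ⟨e, h⟩) ∘ fun e : {e // e ∉ T0} => e.1)
        = (X : {e // e ∉ T0} → MvPolynomial {e // e ∉ T0} k) := by
      funext e
      simp [e.2]
    rw [this, aeval_X_left_apply]

theorem cutIdeal_complex_shellable_and_CM
    {V E : Type} [Fintype V] [Fintype E] [DecidableEq E] (k : Type) [Field k]
    (G : DirGraph V E) (q : V)
    (hq : ∀ e, G.head e ≠ q)
    (hreach : ∀ v : V, G.ReachIn (univ : Finset E) q v) :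
    IsPureShellable (G.cutIdeal k q) ∧ IsCohenMacaulayQuotient (G.cutIdeal k q) := by
  have hV : VDec {T | G.Arb q T} := DirGraph.vdec_arb hq
  have hcard : ∀ T ∈ {T | G.Arb q T}, T.card = Fintype.card V - 1 :=
    fun T hT => DirGraph.Arb.card_eq hq hT
  obtain ⟨T0, -, h0⟩ := DirGraph.exists_arb _ hreach
  rw [DirGraph.cutIdeal_eq]
  constructor
  · obtain ⟨l, hn, hm, hs⟩ := hV.shell
    refine ⟨l, hn, fun τ => (isSRFacet_sys hcard).trans (hm τ), ?_, ?_⟩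
    · intro τ hτ τ' hτ'
      have h1 := hcard _ ((hm τ).2 hτ)
      have h2 := hcard _ ((hm τ').2 hτ')
      rw [card_compl] at h1 h2
      have := card_le_univ τ
      have := card_le_univ τ'
      omega
    · intro i j hij _
      have hsplit : l = l.take j.1 ++ l.get j :: l.drop (j.1 + 1) := by
        simp
      obtain ⟨F'', hF'', x, hx, h1, h2⟩ := hs _ _ _ hsplit (l.get i) (by
        rw [List.mem_take_iff_getElem]
        exact ⟨i.1, by have := i.2; have : i.1 < j.1 := hij; omega, rfl⟩)
      rw [List.mem_take_iff_getElem] at hF''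
      obtain ⟨m, hm', rfl⟩ := hF''
      exact ⟨⟨m, by omega⟩, by rw [Fin.lt_def]; simp; omega, x, hx, h1, h2⟩
  · have hT0 := DirGraph.Arb.transv hq h0
    choose ρ hρ using hT0.2
    have hwr := hV.wr (k := k) G.head T0 hT0 ρ hρ (T0ᶜ).toList (nodup_toList _)
      (by simp) (fun T hT => DirGraph.Arb.transv hq hT)
    have hrs : ∀ r ∈ (T0ᶜ).toList.map (fun e => (X e - X (ρ e) : MvPolynomial E k)),
        r ∈ Ideal.span (Set.range (X : E → MvPolynomial E k)) := by
      intro r hr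
      obtain ⟨e, _, rfl⟩ := List.mem_map.1 hr
      exact Ideal.sub_mem _ (Ideal.subset_span ⟨e, rfl⟩) (Ideal.subset_span ⟨_, rfl⟩)
    refine ⟨_, hrs, ⟨hwr.isWeaklyRegular, ?_⟩, ?_⟩
    · have hker : Ideal.span (Set.range (X : E → MvPolynomial E k)) ≤
          RingHom.ker (constantCoeff (σ := E) (R := k)) := by
        rw [Ideal.span_le]
        rintro _ ⟨e, rfl⟩
        simp [RingHom.mem_ker]
      have hI : ∀ a ∈ sysIdeal k {T | G.Arb q T}, constantCoeff a = 0 := by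
        intro a ha
        have h1 : sysIdeal k {T | G.Arb q T} ≤ Ideal.span (X '' (T0 : Set E)) := iInf₂_le T0 h0
        exact hker (Ideal.span_mono (Set.image_subset_range _ _) (h1 ha))
      let ψ := Ideal.Quotient.lift _ (constantCoeff (σ := E) (R := k)) hI
      intro htop
      have h1 : (1 : MvPolynomial E k ⧸ sysIdeal k {T | G.Arb q T}) ∈
          (⊤ : Submodule (MvPolynomial E k) (MvPolynomial E k ⧸ sysIdeal k {T | G.Arb q T})) :=
        trivial
      rw [htop] at h1
      have h2 : ψ 1 = 0 := by
        refine Submodule.smul_induction_on h1 (p := fun y => ψ y = 0) ?_ ?_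
        · intro r hr y _
          have : r ∈ RingHom.ker (constantCoeff (σ := E) (R := k)) :=
            hker ((Ideal.span_le (I := Ideal.span (Set.range X))).2 hrs hr)
          rw [RingHom.mem_ker] at this
          obtain ⟨f, rfl⟩ := Ideal.Quotient.mk_surjective y
          have e1 : r • Ideal.Quotient.mk (sysIdeal k {T | G.Arb q T}) f =
            Ideal.Quotient.mk (sysIdeal k {T | G.Arb q T}) (r * f) := rfl
          rw [e1]
          simp [ψ, this]
        · intro a b ha hb
          rw [map_add, ha, hb, add_zero]
      rw [map_one] at h2
      exact one_ne_zero h2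
    · rw [dim_sys hcard T0 h0, List.length_map, length_toList, card_compl, hcard T0 h0]

end
end

section
/- Let G be a graph on n vertices with a distinguished vertex q. The Betti numbers of the ideals 𝔗_G and 𝔗_G^q are independent of the characteristic of the base field k; for all i ≥ 0, β_{i,n−1+i}(𝔗_G) = β_i(𝔗_G) = |𝔖_i(G,q)|, and for each multidegree j ∈ ℤ^n, β_{i,j}(𝔗_G) = |𝔖_{i,j}(G,q)|, the number of acyclic orientations with unique source q on the subgraph induced on the edges in the support of j having n − 1 + i edges. -/
/-!
STATEMENT 17: The Betti numbers of `𝔗_G` and `𝔗_G^q` are independent of the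
characteristic of the base field; `β_{i,n-1+i}(𝔗_G) = β_i(𝔗_G) = |𝔖_i(G,q)|`, and
for each multidegree `j`, `β_{i,j}(𝔗_G) = |𝔖_{i,j}(G,q)|`.
-/

open Finset MvPolynomial

noncomputable section

open scoped Classical

/-- A finite, unweighted multigraph without loops. -/
structure Multigraph (V E : Type) where
  fst : E → V
  snd : E → V
  no_loop : ∀ e, fst e ≠ snd e

namespace Multigraph

variable {V E : Type} (G : Multigraph V E)

/-- Head of a dart. -/
def dhead (d : E × Bool) : V := if d.2 then G.snd d.1 else G.fst d.1

/-- Tail of a dart. -/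
def dtail (d : E × Bool) : V := if d.2 then G.fst d.1 else G.snd d.1

/-- Adjacency. -/
def Adj (u v : V) : Prop := ∃ d : E × Bool, G.dtail d = u ∧ G.dhead d = v

/-- Connectivity. -/
def Connected : Prop := ∀ u v : V, Relation.ReflTransGen G.Adj u v

/-- A directed cycle. -/
def IsDirCycle (l : List (E × Bool)) : Prop :=
  l ≠ [] ∧ l.Nodup ∧ l.Chain' (fun d d' => G.dhead d = G.dtail d') ∧
    ∀ h : l ≠ [], G.dhead (l.getLast h) = G.dtail (l.head h)

/-- Acyclicity of a set of darts. -/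
def Acyclic (T : Finset (E × Bool)) : Prop :=
  ∀ l : List (E × Bool), (∀ d ∈ l, d ∈ T) → ¬ G.IsDirCycle l

/-- Reachability via darts of `P`. -/
def ReachIn (P : Finset (E × Bool)) (u v : V) : Prop :=
  Relation.ReflTransGen (fun a b => ∃ d ∈ P, G.dtail d = a ∧ G.dhead d = b) u v

variable [Fintype V] [Fintype E] [DecidableEq V] [DecidableEq E]

/-- An oriented `i`-spanning tree of `(G, q)`. -/
def IsOrientedSpanningTree (q : V) (k : ℕ) (T : Finset (E × Bool)) : Prop :=
  T.card = Fintype.card V - 1 + k ∧ G.Acyclic T ∧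
    (∀ v : V, G.ReachIn T q v) ∧ (∀ d ∈ T, G.dhead d ≠ q)

/-- An (undirected) spanning tree of `G`. -/
def IsSpanningTree (T : Finset E) : Prop :=
  T.card = Fintype.card V - 1 ∧
    ∀ u v : V, Relation.ReflTransGen
      (fun a b => ∃ d : E × Bool, d.1 ∈ T ∧ G.dtail d = a ∧ G.dhead d = b) u v

end Multigraph

variable {V E : Type} [Fintype V] [Fintype E] [DecidableEq V] [DecidableEq E]

/-- The spanning tree ideal `𝔗_G ⊆ R = k[x_e : e ∈ E(G)]`. -/
def spanningTreeIdeal (kk : Type) [Field kk] (G : Multigraph V E) :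
    Ideal (MvPolynomial E kk) :=
  Ideal.span {p | ∃ T : Finset E, G.IsSpanningTree T ∧ p = ∏ e ∈ T, X e}

/-- The oriented spanning tree ideal `𝔗_G^q ⊆ S = k[y_e : e ∈ 𝔼(G)]`. -/
def orientedSpanningTreeIdeal (kk : Type) [Field kk] (G : Multigraph V E) (q : V) :
    Ideal (MvPolynomial (E × Bool) kk) :=
  Ideal.span {p | ∃ T : Finset (E × Bool), G.IsOrientedSpanningTree q 0 T ∧
    p = ∏ d ∈ T, X d}

/-- The underlying (undirected) multidegree of a set of darts. -/
def edgeDegOf (T : Finset (E × Bool)) : E →₀ ℕ :=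
  Finsupp.equivFunOnFinite.symm
    (fun e => (if (e, true) ∈ T then 1 else 0) + (if (e, false) ∈ T then 1 else 0))

/-- A minimal multigraded free resolution of an ideal `I ⊆ k[x_i : i ∈ σ]`. -/
structure MinFreeRes (k : Type) [Field k] (σ : Type) [Fintype σ]
    (I : Ideal (MvPolynomial σ k)) where
  F : ℕ → Type
  finite : ∀ i, Finite (F i)
  deg : (i : ℕ) → F i → (σ →₀ ℕ)
  eps : (F 0 →₀ MvPolynomial σ k) →ₗ[MvPolynomial σ k] MvPolynomial σ k
  d : (i : ℕ) →
    ((F (i + 1) →₀ MvPolynomial σ k) →ₗ[MvPolynomial σ k] (F i →₀ MvPolynomial σ k))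
  eps_graded : ∀ g : F 0, ∃ a : k, eps (Finsupp.single g 1) = monomial (deg 0 g) a
  d_graded : ∀ (i : ℕ) (g : F (i + 1)) (g' : F i),
    (deg i g' ≤ deg (i + 1) g ∧
      ∃ a : k, (d i (Finsupp.single g 1)) g' = monomial (deg (i + 1) g - deg i g') a) ∨
    (d i (Finsupp.single g 1)) g' = 0
  range_eps : LinearMap.range eps = I
  exact_eps : LinearMap.ker eps = LinearMap.range (d 0)
  exact_d : ∀ i : ℕ, LinearMap.ker (d i) = LinearMap.range (d (i + 1))
  minimal : ∀ (i : ℕ) (g : F (i + 1)) (g' : F i),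
    constantCoeff ((d i (Finsupp.single g 1)) g') = 0


/-- support condition -/
def SupIn {k α M : Type} [Zero k] (dg : α → M) (X : Set M) (c : α → k) : Prop :=
  ∀ g, c g ≠ 0 → dg g ∈ X

theorem SupIn.mono {k α M : Type} [Zero k] {dg : α → M} {X Y : Set M} {c : α → k}
    (h : SupIn dg X c) (hXY : X ⊆ Y) : SupIn dg Y c := fun g hg => hXY (h g hg)

theorem SupIn.add {k α M : Type} [Field k] {dg : α → M} {X : Set M} {c c' : α → k}
    (h : SupIn dg X c) (h' : SupIn dg X c') : SupIn dg X (c + c') := by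
  intro g hg
  by_cases h1 : c g = 0
  · exact h' g (by intro h2; exact hg (by simp [h1, h2]))
  · exact h g h1

theorem SupIn.neg {k α M : Type} [Field k] {dg : α → M} {X : Set M} {c : α → k}
    (h : SupIn dg X c) : SupIn dg X (-c) := fun g hg => h g (by simpa using hg)

theorem SupIn.sub {k α M : Type} [Field k] {dg : α → M} {X : Set M} {c c' : α → k}
    (h : SupIn dg X c) (h' : SupIn dg X c') : SupIn dg X (c - c') := by
  rw [sub_eq_add_neg]; exact h.add h'.neg

theorem SupIn.smul {k α M : Type} [Field k] {dg : α → M} {X : Set M} {c : α → k} (a : k)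
    (h : SupIn dg X c) : SupIn dg X (a • c) := by
  intro g hg
  exact h g (by intro h0; exact hg (by simp [h0]))

theorem SupIn.zero {k α M : Type} [Field k] {dg : α → M} {X : Set M} :
    SupIn dg X (0 : α → k) := fun g hg => absurd rfl hg

theorem SupIn.inter {k α M : Type} [Field k] {dg : α → M} {X Y : Set M} {c : α → k}
    (h : SupIn dg X c) (h' : SupIn dg Y c) : SupIn dg (X ∩ Y) c :=
  fun g hg => ⟨h g hg, h' g hg⟩

theorem SupIn.split {k α M : Type} [Field k] {dg : α → M} {X Y : Set M} {c : α → k}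
    (h : SupIn dg (X ∪ Y) c) : ∃ u v : α → k, c = u + v ∧ SupIn dg X u ∧ SupIn dg Y v := by
  refine ⟨fun g => if dg g ∈ X then c g else 0, fun g => if dg g ∈ X then 0 else c g, ?_, ?_, ?_⟩
  · funext g; by_cases hg : dg g ∈ X <;> simp [hg]
  · intro g hg; by_contra h1; simp [h1] at hg
  · intro g hg
    by_cases h1 : dg g ∈ X
    · simp [h1] at hg
    · simp only [h1, if_false] at hg
      exact (h g hg).resolve_left h1

/-- The based complex obtained from a multigraded free resolution by setting variables to 1. -/
structure SCx (k : Type) [Field k] (σ : Type) (U : (σ →₀ ℕ) → Prop) where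
  F : ℕ → Type
  fin : ∀ i, Finite (F i)
  deg : (i : ℕ) → F i → (σ →₀ ℕ)
  del : (i : ℕ) → (F (i + 1) → k) →ₗ[k] (F i → k)
  eps : (F 0 → k) →ₗ[k] k
  del_lt : ∀ i c g', del i c g' ≠ 0 → ∃ g, c g ≠ 0 ∧ deg i g' < deg (i + 1) g
  dd : ∀ i c, del i (del (i + 1) c) = 0
  ed : ∀ c, eps (del 0 c) = 0
  ex0 : ∀ b z, SupIn (deg 0) (Set.Iic b) z → eps z = 0 →
    ∃ w, SupIn (deg 1) (Set.Iic b) w ∧ del 0 w = z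
  ex : ∀ i b z, SupIn (deg (i + 1)) (Set.Iic b) z → del i z = 0 →
    ∃ w, SupIn (deg (i + 2)) (Set.Iic b) w ∧ del (i + 1) w = z
  epsU : ∀ b, U b → ∃ z, SupIn (deg 0) (Set.Iic b) z ∧ eps z = 1
  epsN : ∀ b z, SupIn (deg 0) (Set.Iic b) z → ¬ U b → eps z = 0

namespace SCx

variable {k : Type} [Field k] {σ : Type} {U : (σ →₀ ℕ) → Prop} (C : SCx k σ U)

theorem del_sup {i : ℕ} {X : Set (σ →₀ ℕ)} (hX : IsLowerSet X) {c : C.F (i + 1) → k}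
    (h : SupIn (C.deg (i + 1)) X c) : SupIn (C.deg i) X (C.del i c) := by
  intro g' hg'
  obtain ⟨g, hg, hlt⟩ := C.del_lt i c g' hg'
  exact hX hlt.le (h g hg)

/-- relative homology vanishes -/
def Van : ℕ → Set (σ →₀ ℕ) → Set (σ →₀ ℕ) → Prop
  | 0, X, Y => ∀ z : C.F 0 → k, SupIn (C.deg 0) X z →
      ∃ w : C.F 1 → k, SupIn (C.deg 1) X w ∧ SupIn (C.deg 0) Y (z - C.del 0 w)
  | i + 1, X, Y => ∀ z : C.F (i + 1) → k, SupIn (C.deg (i + 1)) X z →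
      SupIn (C.deg i) Y (C.del i z) →
      ∃ w : C.F (i + 2) → k, SupIn (C.deg (i + 2)) X w ∧
        SupIn (C.deg (i + 1)) Y (z - C.del (i + 1) w)

theorem van_zero_mono {X Y Y' : Set (σ →₀ ℕ)} (h : C.Van 0 X Y) (hY : Y ⊆ Y') :
    C.Van 0 X Y' := by
  intro z hz
  obtain ⟨w, hw, hw'⟩ := h z hz
  exact ⟨w, hw, hw'.mono hY⟩

theorem van_step {i : ℕ} {X Y X' : Set (σ →₀ ℕ)} (hY : IsLowerSet Y)
    (hX' : IsLowerSet X') (hXX : X' ⊆ X) (h1 : C.Van (i + 1) X Y) (h2 : C.Van i X' (X' ∩ Y)) :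
    C.Van (i + 1) X (X' ∪ Y) := by
  intro z hz hdz
  obtain ⟨u, v, huv, hu, hv⟩ := hdz.split
  have key : ∃ w : C.F (i + 1) → k, SupIn (C.deg (i + 1)) X' w ∧
      SupIn (C.deg i) (X' ∩ Y) (u - C.del i w) := by
    cases i with
    | zero => exact h2 u hu
    | succ i =>
      apply h2 u hu
      apply (C.del_sup hX' hu).inter
      have h0 : C.del i (u + v) = 0 := by rw [← huv]; exact C.dd i z
      rw [map_add] at h0
      rw [eq_neg_of_add_eq_zero_left h0]
      exact (C.del_sup hY hv).neg
  obtain ⟨w, hw, hw'⟩ := key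
  obtain ⟨t, ht, ht'⟩ := h1 (z - w) (hz.sub (hw.mono hXX)) (by
    rw [map_sub, huv]
    have : u + v - C.del i w = (u - C.del i w) + v := by abel
    rw [this]
    exact (hw'.mono Set.inter_subset_right).add hv)
  refine ⟨t, ht, ?_⟩
  have : z - C.del (i + 1) t = (z - w - C.del (i + 1) t) + w := by abel
  rw [this]
  exact (ht'.mono Set.subset_union_right).add (hw.mono Set.subset_union_left)

theorem van_base (b b' : σ →₀ ℕ) (hb : b' ≤ b) (hU : U b ↔ U b') (i : ℕ) :
    C.Van i (Set.Iic b) (Set.Iic b') := by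
  have hI : Set.Iic b' ⊆ Set.Iic b := Set.Iic_subset_Iic.2 hb
  match i with
  | 0 =>
    intro z hz
    have : ∃ y, SupIn (C.deg 0) (Set.Iic b') y ∧ C.eps (z - y) = 0 := by
      by_cases h : U b
      · obtain ⟨y, hy, hy1⟩ := C.epsU b' (hU.1 h)
        exact ⟨C.eps z • y, hy.smul _, by simp [hy1]⟩
      · exact ⟨0, SupIn.zero, by simpa using C.epsN b z hz h⟩
    obtain ⟨y, hy, hy0⟩ := this
    obtain ⟨w, hw, hw'⟩ := C.ex0 b (z - y) (hz.sub (hy.mono hI)) hy0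
    refine ⟨w, hw, ?_⟩
    rw [hw']; simpa using hy
  | 1 =>
    intro z hz hdz
    obtain ⟨y, hy, hy'⟩ := C.ex0 b' _ hdz (C.ed z)
    obtain ⟨w, hw, hw'⟩ := C.ex 0 b (z - y) (hz.sub (hy.mono hI)) (by simp [hy'])
    refine ⟨w, hw, ?_⟩
    rw [hw']; simpa using hy
  | i + 2 =>
    intro z hz hdz
    obtain ⟨y, hy, hy'⟩ := C.ex i b' _ hdz (C.dd i z)
    obtain ⟨w, hw, hw'⟩ := C.ex (i + 1) b (z - y) (hz.sub (hy.mono hI)) (by simp [hy'])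
    refine ⟨w, hw, ?_⟩
    rw [hw']; simpa using hy

/-- the lower part -/
def NN (b : σ →₀ ℕ) (A : Finset σ) : Set (σ →₀ ℕ) := {m | m ≤ b ∧ ∃ a ∈ A, m a < b a}

theorem nn_lower (b : σ →₀ ℕ) (A : Finset σ) : IsLowerSet (NN b A) := by
  rintro m m' h ⟨h1, a, ha, h2⟩
  exact ⟨h.trans h1, a, ha, (h a).trans_lt h2⟩

theorem nn_empty (b : σ →₀ ℕ) : NN b ∅ = ∅ := by
  ext m; simp [NN]

theorem nn_singleton [DecidableEq σ] (b : σ →₀ ℕ) (e : σ) (he : 1 ≤ b e) :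
    NN b {e} = Set.Iic (b - Finsupp.single e 1) := by
  ext m
  simp only [NN, Set.mem_ofPred_eq, Set.mem_Iic, Finset.mem_singleton, exists_eq_left]
  constructor
  · rintro ⟨h1, h2⟩ x
    have := h1 x
    by_cases hx : x = e
    · subst hx; simp; omega
    · simp [Finsupp.single_apply, Ne.symm hx]; omega
  · intro h
    refine ⟨h.trans tsub_le_self, ?_⟩
    have := h e
    simp at this; omega

theorem nn_insert [DecidableEq σ] (b : σ →₀ ℕ) (A : Finset σ) (e : σ) (he : 1 ≤ b e) :
    NN b (insert e A) = Set.Iic (b - Finsupp.single e 1) ∪ NN b A := by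
  rw [← nn_singleton b e he]
  ext m
  simp only [NN, Set.mem_ofPred_eq, Set.mem_union, Finset.mem_singleton, exists_eq_left,
    Finset.exists_mem_insert]
  tauto

theorem nn_sub [DecidableEq σ] (b : σ →₀ ℕ) (A : Finset σ) (e : σ) (heA : e ∉ A) :
    NN (b - Finsupp.single e 1) A = Set.Iic (b - Finsupp.single e 1) ∩ NN b A := by
  ext m
  simp only [NN, Set.mem_ofPred_eq, Set.mem_inter_iff, Set.mem_Iic]
  have : ∀ a ∈ A, (b - Finsupp.single e 1 : σ →₀ ℕ) a = b a := by
    intro a ha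
    have : e ≠ a := fun h => heA (h ▸ ha)
    simp [Finsupp.single_apply, this]
  constructor
  · rintro ⟨h1, a, ha, h2⟩
    exact ⟨h1, h1.trans tsub_le_self, a, ha, this a ha ▸ h2⟩
  · rintro ⟨h1, _, a, ha, h2⟩
    exact ⟨h1, a, ha, (this a ha).symm ▸ h2⟩

theorem van_insert [DecidableEq σ] (b : σ →₀ ℕ) (A : Finset σ) (e : σ) (he : 1 ≤ b e)
    (heA : e ∉ A) (i : ℕ) (h1 : C.Van i (Set.Iic b) (NN b A))
    (h2 : ∀ j, i = j + 1 →
      C.Van j (Set.Iic (b - Finsupp.single e 1)) (NN (b - Finsupp.single e 1) A)) :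
    C.Van i (Set.Iic b) (NN b (insert e A)) := by
  rw [nn_insert b A e he]
  cases i with
  | zero => exact C.van_zero_mono h1 Set.subset_union_right
  | succ i =>
    refine C.van_step (nn_lower _ _) (isLowerSet_Iic _)
      (Set.Iic_subset_Iic.2 tsub_le_self) h1 ?_
    rw [← nn_sub b A e heA]
    exact h2 i rfl

/-- indicator -/
def ind (S : Finset σ) : σ →₀ ℕ := Finsupp.indicator S (fun _ _ => 1)

theorem ind_apply [DecidableEq σ] (S : Finset σ) (a : σ) : ind S a = if a ∈ S then 1 else 0 := by
  simp [ind, Finsupp.indicator_apply]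

theorem van_Z [DecidableEq σ] (e : σ) (A : Finset σ) : ∀ (_ : e ∉ A) (b : σ →₀ ℕ) (_ : 1 ≤ b e)
    (_ : ∀ a ∈ A, 1 ≤ b a)
    (_ : ∀ X ⊆ A, (U (b - ind X) ↔ U (b - ind X - Finsupp.single e 1))) (i : ℕ),
    C.Van i (Set.Iic b) (NN b (insert e A)) := by
  induction A using Finset.induction_on with
  | empty =>
    intro _ b he _ hU i
    have h0 := hU ∅ (by simp)
    have : (ind ∅ : σ →₀ ℕ) = 0 := by ext a; simp [ind_apply]
    rw [this, tsub_zero] at h0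
    have := nn_singleton b e he
    simp only [insert_empty_eq]
    rw [this]
    exact C.van_base _ _ tsub_le_self h0 i
  | insert f A hf ih =>
    intro he b hbe hbA hU i
    simp only [Finset.mem_insert, not_or] at he
    rw [Finset.insert_comm]
    have hfe : f ∉ insert e A := by simp [hf, Ne.symm he.1]
    apply C.van_insert b (insert e A) f (hbA f (by simp)) hfe
    · exact ih he.2 b hbe (fun a ha => hbA a (by simp [ha]))
        (fun X hX => hU X (hX.trans (Finset.subset_insert _ _))) i
    · rintro j -
      apply ih he.2
      · simp [Finsupp.single_apply, Ne.symm he.1, hbe]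
      · intro a ha
        have : f ≠ a := fun h => hf (h ▸ ha)
        simp [Finsupp.single_apply, this, hbA a (Finset.mem_insert_of_mem ha)]
      · intro X hX
        have h1 := hU (insert f X) (Finset.insert_subset_insert _ hX)
        have h2 : b - Finsupp.single f 1 - ind X = b - ind (insert f X) := by
          ext a
          simp only [Finsupp.tsub_apply, ind_apply, Finsupp.single_apply, Finset.mem_insert]
          have hfX : f ∉ X := fun h => hf (hX h)
          by_cases ha : a = f
          · subst ha; simp [hfX]
          · simp [ha, Ne.symm ha]
        rw [h2]; exact h1

theorem van_empty (b : σ →₀ ℕ) (i : ℕ) (h : i = 0 → ¬ U b) :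
    C.Van i (Set.Iic b) (NN b ∅) := by
  rw [nn_empty]
  cases i with
  | zero =>
    intro z hz
    obtain ⟨w, hw, hw'⟩ := C.ex0 b z hz (C.epsN b z hz (h rfl))
    exact ⟨w, hw, by rw [hw', sub_self]; exact SupIn.zero⟩
  | succ i =>
    intro z hz hdz
    have : C.del i z = 0 := by
      funext g; by_contra hg; exact hdz g hg
    obtain ⟨w, hw, hw'⟩ := C.ex i b z hz this
    exact ⟨w, hw, by rw [hw', sub_self]; exact SupIn.zero⟩

theorem no_gen [DecidableEq σ] (b : σ →₀ ℕ) (i : ℕ) (A : Finset σ)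
    (h : C.Van i (Set.Iic b) (NN b A)) (hA : ∀ a, b a ≠ 0 → a ∈ A) (g : C.F i) :
    C.deg i g ≠ b := by
  intro hg
  have hs : SupIn (C.deg i) (Set.Iic b) (Pi.single g (1 : k)) := by
    intro g' hg'
    by_cases h1 : g' = g
    · subst h1; exact hg.le
    · simp [Pi.single_apply, h1] at hg'
  have hlt : ∀ m, m < b → m ∈ NN b A := by
    intro m hm
    refine ⟨hm.le, ?_⟩
    by_contra hcon
    push Not at hcon
    refine hm.not_ge (fun a => ?_)
    by_cases ha : b a = 0
    · omega
    · exact hcon a (hA a ha)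
  have hn : ∀ w : C.F (i + 1) → k, SupIn (C.deg (i + 1)) (Set.Iic b) w →
      SupIn (C.deg i) (NN b A) (Pi.single g (1 : k) - C.del i w) → False := by
    intro w hw h1
    have h0 : C.del i w g = 0 := by
      by_contra h0
      obtain ⟨g2, h2, h3⟩ := C.del_lt i w g h0
      exact (h3.trans_le (hw g2 h2)).ne hg
    obtain ⟨_, a, _, h2⟩ := h1 g (by simp [h0])
    rw [hg] at h2
    exact lt_irrefl _ h2
  cases i with
  | zero =>
    obtain ⟨w, hw, hw'⟩ := h _ hs
    exact hn w hw hw'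
  | succ i =>
    obtain ⟨w, hw, hw'⟩ := h _ hs (by
      intro g' hg'
      obtain ⟨g2, h2, h3⟩ := C.del_lt i _ g' hg'
      exact hlt _ (h3.trans_le (hs g2 h2)))
    exact hn w hw hw'

theorem ind_sub [DecidableEq σ] (S X : Finset σ) : ind S - ind X = ind (S \ X) := by
  ext a
  simp only [Finsupp.tsub_apply, ind_apply, Finset.mem_sdiff]
  split_ifs <;> simp_all

theorem ind_sub_single [DecidableEq σ] (S : Finset σ) (e : σ) :
    ind S - Finsupp.single e 1 = ind (S.erase e) := by
  ext a
  simp only [Finsupp.tsub_apply, ind_apply, Finset.mem_erase, Finsupp.single_apply]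
  split_ifs <;> simp_all

theorem van_main [DecidableEq σ] (D : Finset σ) (r : Finset σ → ℕ) (N : ℕ)
    (hr : ∀ B e, e ∉ B → insert e B ⊆ D → r (insert e B) = r B + 1 ∨
      (∀ S, insert e B ⊆ S → S ⊆ D → (U (ind S) ↔ U (ind (S.erase e)))))
    (hN : ∀ S ⊆ D, U (ind S) → r S = N) (A : Finset σ) :
    ∀ S, A ⊆ S → S ⊆ D → ∀ i : ℕ, i + N ≠ A.card + r (S \ A) →
      C.Van i (Set.Iic (ind S)) (NN (ind S) A) := by
  induction A using Finset.induction_on with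
  | empty =>
    intro S _ hSD i hi
    apply C.van_empty
    rintro rfl hU
    have := hN S hSD hU
    simp at hi; omega
  | insert e A he ih =>
    intro S hS hSD i hi
    have heS : e ∈ S := hS (by simp)
    have hAS : A ⊆ S := (Finset.subset_insert _ _).trans hS
    have hBe : insert e (S \ insert e A) = S \ A := by
      ext a; simp only [Finset.mem_insert, Finset.mem_sdiff]
      by_cases h : a = e
      · subst h; simp [heS, he]
      · simp [h]
    rcases hr (S \ insert e A) e (by simp) (by rw [hBe]; exact Finset.sdiff_subset.trans hSD)
      with h | h
    · rw [hBe] at h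
      rw [Finset.card_insert_of_notMem he] at hi
      apply C.van_insert _ _ _ (by simp [ind_apply, heS]) he
      · exact ih S hAS hSD i (by omega)
      · rintro j rfl
        rw [ind_sub_single]
        apply ih
        · intro a ha
          exact Finset.mem_erase.2 ⟨fun h => he (h ▸ ha), hAS ha⟩
        · exact (Finset.erase_subset _ _).trans hSD
        · have : S.erase e \ A = S \ insert e A := by
            ext a; simp only [Finset.mem_erase, Finset.mem_insert, Finset.mem_sdiff]; tauto
          rw [this]; omega
    · apply C.van_Z e A he
      · simp [ind_apply, heS]
      · intro a ha; simp [ind_apply, hAS ha]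
      · intro X hX
        rw [ind_sub, ind_sub_single]
        apply h
        · rw [hBe]; exact Finset.sdiff_subset_sdiff le_rfl hX
        · exact Finset.sdiff_subset.trans hSD

end SCx

theorem finrank_map_inf {k M M' : Type} [Field k] [AddCommGroup M] [Module k M]
    [AddCommGroup M'] [Module k M'] (f : M →ₗ[k] M') (p : Submodule k M) [FiniteDimensional k M] :
    Module.finrank k p = Module.finrank k (p.map f) +
      Module.finrank k (p ⊓ LinearMap.ker f : Submodule k M) := by
  rw [← LinearMap.finrank_range_add_finrank_ker (f.domRestrict p), LinearMap.range_domRestrict,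
    LinearMap.ker_domRestrict, ← Submodule.finrank_map_subtype_eq p, Submodule.map_comap_subtype]

namespace SCx

variable {k : Type} [Field k] {σ : Type} {U : (σ →₀ ℕ) → Prop} (C : SCx k σ U)

/-- strand -/
def Vs (i : ℕ) (b : σ →₀ ℕ) : Submodule k (C.F i → k) where
  carrier := {c | SupIn (C.deg i) (Set.Iic b) c}
  add_mem' h h' := SupIn.add h h'
  zero_mem' := SupIn.zero
  smul_mem' a _ h := SupIn.smul a h

/-- number of generators -/
def cnt (i : ℕ) (b : σ →₀ ℕ) : ℕ := Nat.card {g : C.F i // C.deg i g ≤ b}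

theorem finrank_Vs (i : ℕ) (b : σ →₀ ℕ) : Module.finrank k (C.Vs i b) = C.cnt i b := by
  have := C.fin i
  have := Fintype.ofFinite (C.F i)
  have e : C.Vs i b ≃ₗ[k] ({g : C.F i // C.deg i g ≤ b} → k) :=
    { toFun := fun c g => c.1 g.1
      map_add' := fun _ _ => rfl
      map_smul' := fun _ _ => rfl
      invFun := fun c => ⟨fun g => if h : C.deg i g ≤ b then c ⟨g, h⟩ else 0, by
        intro g hg
        by_contra h
        have h' : ¬ C.deg i g ≤ b := h
        simp [h'] at hg⟩
      left_inv := by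
        rintro ⟨c, hc⟩
        ext g
        by_cases h : C.deg i g ≤ b
        · simp [h]
        · have : c g = 0 := by
            by_contra h1
            exact h (hc g h1)
          simp [h, this]
      right_inv := by
        intro c
        funext g
        simp [g.2] }
  rw [e.finrank_eq, Module.finrank_fintype_fun_eq_card, cnt, Nat.card_eq_fintype_card]

/-- rank -/
def rk (i : ℕ) (b : σ →₀ ℕ) : ℕ := Module.finrank k ((C.Vs (i + 1) b).map (C.del i))

theorem cnt_zero (b : σ →₀ ℕ) : C.cnt 0 b = (if U b then 1 else 0) + C.rk 0 b := by
  have := C.fin 0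
  rw [← finrank_Vs, finrank_map_inf C.eps, rk]
  congr 1
  · split_ifs with h
    · have : (C.Vs 0 b).map C.eps = ⊤ := by
        rw [eq_top_iff]
        rintro x -
        obtain ⟨z, hz, hz1⟩ := C.epsU b h
        exact ⟨x • z, (C.Vs 0 b).smul_mem x hz, by simp [hz1]⟩
      rw [this]; simp
    · have : (C.Vs 0 b).map C.eps = ⊥ := by
        rw [eq_bot_iff]
        rintro x ⟨z, hz, rfl⟩
        exact C.epsN b z hz h
      rw [this]; simp
  · have hs : C.Vs 0 b ⊓ LinearMap.ker C.eps = (C.Vs (0 + 1) b).map (C.del 0) := by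
      ext z
      constructor
      · rintro ⟨h1, h2⟩
        obtain ⟨w, hw, hw'⟩ := C.ex0 b z h1 h2
        exact ⟨w, hw, hw'⟩
      · rintro ⟨w, hw, rfl⟩
        exact ⟨C.del_sup (isLowerSet_Iic b) hw, C.ed w⟩
    rw [hs]

theorem cnt_succ (i : ℕ) (b : σ →₀ ℕ) : C.cnt (i + 1) b = C.rk i b + C.rk (i + 1) b := by
  have := C.fin (i + 1)
  rw [← finrank_Vs, finrank_map_inf (C.del i), rk, rk]
  have hs : C.Vs (i + 1) b ⊓ LinearMap.ker (C.del i) =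
      (C.Vs (i + 1 + 1) b).map (C.del (i + 1)) := by
    ext z
    constructor
    · rintro ⟨h1, h2⟩
      obtain ⟨w, hw, hw'⟩ := C.ex i b z h1 h2
      exact ⟨w, hw, hw'⟩
    · rintro ⟨w, hw, rfl⟩
      exact ⟨C.del_sup (isLowerSet_Iic b) hw, C.dd i w⟩
  rw [hs]

theorem euler_aux (b : σ →₀ ℕ) (m : ℕ) :
    ∑ i ∈ Finset.range (m + 1), (-1 : ℤ) ^ i * C.cnt i b =
      (if U b then 1 else 0) + (-1) ^ m * C.rk m b := by
  induction m with
  | zero => simp [C.cnt_zero b]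
  | succ m ih =>
    rw [Finset.sum_range_succ, ih, C.cnt_succ]
    push_cast
    ring

theorem euler (b : σ →₀ ℕ) (m : ℕ) (h : C.cnt (m + 1) b = 0) :
    ∑ i ∈ Finset.range (m + 1), (-1 : ℤ) ^ i * C.cnt i b = (if U b then 1 else 0) := by
  rw [euler_aux]
  have := C.cnt_succ m b
  have : C.rk m b = 0 := by omega
  simp [this]

/-- Betti number in squarefree degree -/
def bet (i : ℕ) (S : Finset σ) : ℕ := Nat.card {g : C.F i // C.deg i g = ind S}

theorem le_ind [DecidableEq σ] {b : σ →₀ ℕ} {Y : Finset σ} (h : b ≤ ind Y) :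
    b = ind b.support ∧ b.support ⊆ Y := by
  have h1 : ∀ a, b a ≤ if a ∈ Y then 1 else 0 := fun a => ind_apply Y a ▸ h a
  constructor
  · ext a
    have := h1 a
    rw [ind_apply]
    split_ifs at this <;> split_ifs with h2 <;> simp at h2 <;> omega
  · intro a ha
    have := h1 a
    by_contra h2
    simp [h2] at this ha
    exact ha this

theorem ind_support [DecidableEq σ] (S : Finset σ) : (ind S).support = S := by
  ext a; simp [ind_apply]

theorem ind_le_ind [DecidableEq σ] {S Y : Finset σ} : ind S ≤ ind Y ↔ S ⊆ Y := by
  constructor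
  · intro h
    have := (le_ind h).2
    rwa [ind_support] at this
  · intro h a
    rw [ind_apply, ind_apply]
    split_ifs with h1 h2
    · rfl
    · exact absurd (h h1) h2
    · simp
    · simp

theorem cnt_eq [DecidableEq σ] (i : ℕ) (Y : Finset σ) :
    C.cnt i (ind Y) = ∑ D ∈ Y.powerset, C.bet i D := by
  have := C.fin i
  have := Fintype.ofFinite (C.F i)
  simp only [cnt, bet, Nat.card_eq_fintype_card, Fintype.card_subtype]
  rw [Finset.card_eq_sum_card_fiberwise (f := fun g => (C.deg i g).support) (t := Y.powerset)]
  · apply Finset.sum_congr rfl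
    intro D hD
    congr 1
    ext g
    simp only [Finset.mem_filter, Finset.mem_univ, true_and]
    constructor
    · rintro ⟨h1, h2⟩
      rw [← h2]; exact (le_ind h1).1
    · intro h
      rw [h, ind_support]
      exact ⟨ind_le_ind.2 (Finset.mem_powerset.1 hD), rfl⟩
  · intro g hg
    simp at hg
    simpa using (le_ind hg).2

/-- total Betti number in a squarefree degree -/
def btot [Fintype σ] (S : Finset σ) : ℕ := ∑ i ∈ Finset.range (Fintype.card σ + 1), C.bet i S

theorem bet_eq [Fintype σ] (N : ℕ) (hlin : ∀ i S, C.bet i S ≠ 0 → S.card = N + i) (i : ℕ)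
    (S : Finset σ) : C.bet i S = if S.card = N + i then C.btot S else 0 := by
  split_ifs with h
  · rw [btot, Finset.sum_eq_single i]
    · intro j _ hj
      by_contra h1
      have := hlin j S h1
      omega
    · intro h1
      have := Finset.card_le_univ S
      simp at h1
      omega
  · by_contra h1
    exact h (hlin i S h1)

theorem euler_btot [Fintype σ] [DecidableEq σ] (N : ℕ)
    (hlin : ∀ i S, C.bet i S ≠ 0 → S.card = N + i) (Y : Finset σ) :
    ∑ D ∈ Y.powerset, (-1 : ℤ) ^ D.card * C.btot D = (-1) ^ N * (if U (ind Y) then 1 else 0) := by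
  rw [← C.euler (ind Y) (Fintype.card σ)]
  · simp_rw [cnt_eq, btot]
    push_cast
    simp_rw [Finset.mul_sum]
    rw [Finset.sum_comm]
    refine Finset.sum_congr rfl (fun i _ => Finset.sum_congr rfl (fun D _ => ?_))
    by_cases h : C.bet i D = 0
    · simp [h]
    · rw [hlin i D h]; ring
  · rw [cnt_eq]
    apply Finset.sum_eq_zero
    intro D _
    by_contra h
    have := hlin _ D h
    have := Finset.card_le_univ D
    omega

/-- non-squarefree degrees do not occur -/
theorem sqfree [DecidableEq σ] (hU : ∀ b b' : σ →₀ ℕ, b.support = b'.support → (U b ↔ U b'))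
    (i : ℕ) (g : C.F i) : C.deg i g = ind (C.deg i g).support := by
  by_contra hne
  set b := C.deg i g with hb
  have : ∃ e, 2 ≤ b e := by
    by_contra hcon
    push Not at hcon
    apply hne
    ext a
    have := hcon a
    rw [ind_apply]
    split_ifs with h <;> simp at h <;> omega
  obtain ⟨e, he⟩ := this
  have hes : e ∈ b.support := by simp; omega
  have hV := C.van_Z e (b.support.erase e) (by simp) b (by omega)
    (by intro a ha; simp at ha; omega)
    (by
      intro X hX
      apply hU
      ext a
      by_cases hae : a = e
      · subst hae
        have : a ∉ X := fun h => by simpa using hX h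
        simp [ind_apply, this]; omega
      · simp [Finsupp.single_apply, Ne.symm hae]) i
  rw [Finset.insert_erase hes] at hV
  exact C.no_gen b i _ hV (by simp) g hb.symm

theorem bet_zero [DecidableEq σ] (i : ℕ) (S : Finset σ)
    (h : C.Van i (Set.Iic (ind S)) (NN (ind S) S)) : C.bet i S = 0 := by
  have : IsEmpty {g : C.F i // C.deg i g = ind S} :=
    ⟨fun g => C.no_gen (ind S) i S h (by intro a; simp [ind_apply]) g.1 g.2⟩
  simp [bet]

end SCx

theorem lin_expand {R α M : Type} [CommRing R] [AddCommGroup M] [Module R M] [Fintype α]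
    (L : (α →₀ R) →ₗ[R] M) (f : α →₀ R) : L f = ∑ a, f a • L (Finsupp.single a 1) := by
  conv_lhs => rw [← Finsupp.univ_sum_single f, map_sum]
  refine Finset.sum_congr rfl (fun a _ => ?_)
  rw [← map_smul, Finsupp.smul_single_one]

namespace MinFreeRes

variable {k : Type} [Field k] {σ : Type} [Fintype σ] {I : Ideal (MvPolynomial σ k)}
  (Rs : MinFreeRes k σ I)

/-- finiteness of the generators -/
instance ft (i : ℕ) : Fintype (Rs.F i) := @Fintype.ofFinite _ (Rs.finite i)

/-- scalar matrix -/
def sc (i : ℕ) (g : Rs.F (i + 1)) (g' : Rs.F i) : k :=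
  coeff (Rs.deg (i + 1) g - Rs.deg i g') (Rs.d i (Finsupp.single g 1) g')

theorem d_eq (i : ℕ) (g : Rs.F (i + 1)) (g' : Rs.F i) :
    Rs.d i (Finsupp.single g 1) g' =
      monomial (Rs.deg (i + 1) g - Rs.deg i g') (Rs.sc i g g') := by
  rcases Rs.d_graded i g g' with ⟨_, a, h⟩ | h
  · rw [sc, h]; simp
  · rw [sc, h]; simp

theorem sc_lt (i : ℕ) (g : Rs.F (i + 1)) (g' : Rs.F i) (h0 : Rs.sc i g g' ≠ 0) :
    Rs.deg i g' < Rs.deg (i + 1) g := by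
  rcases Rs.d_graded i g g' with ⟨hle, a, h⟩ | h
  · refine lt_of_le_of_ne hle (fun he => h0 ?_)
    have := Rs.minimal i g g'
    rw [sc, he, tsub_self]
    exact this
  · exact absurd (by rw [sc, h]; simp) h0

/-- augmentation scalars -/
def ec (g : Rs.F 0) : k := coeff (Rs.deg 0 g) (Rs.eps (Finsupp.single g 1))

theorem eps_eq (g : Rs.F 0) : Rs.eps (Finsupp.single g 1) = monomial (Rs.deg 0 g) (Rs.ec g) := by
  obtain ⟨a, h⟩ := Rs.eps_graded g
  rw [ec, h]; simp

/-- scalar differential -/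
def del (i : ℕ) : (Rs.F (i + 1) → k) →ₗ[k] (Rs.F i → k) where
  toFun c g' := ∑ g, c g * Rs.sc i g g'
  map_add' c c' := by funext g'; simp [add_mul, Finset.sum_add_distrib]
  map_smul' a c := by funext g'; simp [Finset.mul_sum, mul_assoc]

theorem del_apply (i : ℕ) (c : Rs.F (i + 1) → k) (g' : Rs.F i) :
    Rs.del i c g' = ∑ g, c g * Rs.sc i g g' := rfl

/-- scalar augmentation -/
def aug : (Rs.F 0 → k) →ₗ[k] k where
  toFun c := ∑ g, c g * Rs.ec g
  map_add' c c' := by simp [add_mul, Finset.sum_add_distrib]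
  map_smul' a c := by simp [Finset.mul_sum, mul_assoc]

theorem aug_apply (c : Rs.F 0 → k) : Rs.aug c = ∑ g, c g * Rs.ec g := rfl

/-- extraction of a strand -/
def ext (i : ℕ) (b : σ →₀ ℕ) (f : Rs.F i →₀ MvPolynomial σ k) (g : Rs.F i) : k :=
  if Rs.deg i g ≤ b then coeff (b - Rs.deg i g) (f g) else 0

/-- inclusion of a strand -/
def lft (i : ℕ) (b : σ →₀ ℕ) (c : Rs.F i → k) : Rs.F i →₀ MvPolynomial σ k :=
  Finsupp.equivFunOnFinite.symm (fun g => monomial (b - Rs.deg i g) (c g))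

theorem ext_sup (i : ℕ) (b : σ →₀ ℕ) (f : Rs.F i →₀ MvPolynomial σ k) :
    SupIn (Rs.deg i) (Set.Iic b) (Rs.ext i b f) := by
  intro g hg
  by_contra h
  have h' : ¬ Rs.deg i g ≤ b := h
  simp [ext, h'] at hg

theorem ext_lft (i : ℕ) (b : σ →₀ ℕ) (c : Rs.F i → k) (h : SupIn (Rs.deg i) (Set.Iic b) c) :
    Rs.ext i b (Rs.lft i b c) = c := by
  funext g
  by_cases hg : Rs.deg i g ≤ b
  · simp [ext, lft, hg]
  · have : c g = 0 := by
      by_contra h1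
      exact hg (h g h1)
    simp [ext, hg, this]

theorem d_apply (i : ℕ) (f : Rs.F (i + 1) →₀ MvPolynomial σ k) (g' : Rs.F i) :
    Rs.d i f g' = ∑ g, f g * monomial (Rs.deg (i + 1) g - Rs.deg i g') (Rs.sc i g g') := by
  rw [lin_expand (Rs.d i) f, Finsupp.finsetSum_apply]
  refine Finset.sum_congr rfl (fun g _ => ?_)
  rw [Finsupp.smul_apply, d_eq, smul_eq_mul]

theorem eps_apply (f : Rs.F 0 →₀ MvPolynomial σ k) :
    Rs.eps f = ∑ g, f g * monomial (Rs.deg 0 g) (Rs.ec g) := by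
  rw [lin_expand Rs.eps f]
  refine Finset.sum_congr rfl (fun g _ => ?_)
  rw [eps_eq, smul_eq_mul]

theorem ext_d (i : ℕ) (b : σ →₀ ℕ) (f : Rs.F (i + 1) →₀ MvPolynomial σ k) :
    Rs.ext i b (Rs.d i f) = Rs.del i (Rs.ext (i + 1) b f) := by
  funext g'
  rw [del_apply, ext, d_apply]
  by_cases hb : Rs.deg i g' ≤ b
  · rw [if_pos hb, coeff_sum]
    refine Finset.sum_congr rfl (fun g _ => ?_)
    by_cases h0 : Rs.sc i g g' = 0
    · simp [h0]
    have hlt := Rs.sc_lt i g g' h0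
    rw [coeff_mul_monomial', ext]
    have hiff : Rs.deg (i + 1) g - Rs.deg i g' ≤ b - Rs.deg i g' ↔ Rs.deg (i + 1) g ≤ b := by
      rw [tsub_le_iff_right, tsub_add_cancel_of_le hb]
    by_cases h1 : Rs.deg (i + 1) g ≤ b
    · rw [if_pos (hiff.2 h1), if_pos h1]
      congr 2
      exact tsub_tsub_tsub_cancel_right hlt.le
    · rw [if_neg (fun h => h1 (hiff.1 h)), if_neg h1, zero_mul]
  · rw [if_neg hb]
    symm
    apply Finset.sum_eq_zero
    intro g _
    by_cases h0 : Rs.sc i g g' = 0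
    · simp [h0]
    have hlt := Rs.sc_lt i g g' h0
    rw [ext, if_neg (fun h => hb (hlt.le.trans h)), zero_mul]

theorem coeff_eps (b : σ →₀ ℕ) (f : Rs.F 0 →₀ MvPolynomial σ k) :
    coeff b (Rs.eps f) = Rs.aug (Rs.ext 0 b f) := by
  rw [aug_apply, eps_apply, coeff_sum]
  refine Finset.sum_congr rfl (fun g _ => ?_)
  rw [coeff_mul_monomial', ext]
  split_ifs <;> simp

theorem d_lft (i : ℕ) (b : σ →₀ ℕ) (c : Rs.F (i + 1) → k)
    (h : SupIn (Rs.deg (i + 1)) (Set.Iic b) c) :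
    Rs.d i (Rs.lft (i + 1) b c) = Rs.lft i b (Rs.del i c) := by
  ext1 g'
  rw [d_apply]
  simp only [lft, Finsupp.equivFunOnFinite_symm_apply_apply, del_apply, map_sum]
  refine Finset.sum_congr rfl (fun g _ => ?_)
  rw [monomial_mul]
  by_cases h0 : c g * Rs.sc i g g' = 0
  · simp [h0]
  have h1 := h g (left_ne_zero_of_mul h0)
  have h2 := Rs.sc_lt i g g' (right_ne_zero_of_mul h0)
  rw [tsub_add_tsub_cancel h1 h2.le]

theorem eps_lft (b : σ →₀ ℕ) (c : Rs.F 0 → k) (h : SupIn (Rs.deg 0) (Set.Iic b) c) :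
    Rs.eps (Rs.lft 0 b c) = monomial b (Rs.aug c) := by
  rw [eps_apply]
  simp only [lft, Finsupp.equivFunOnFinite_symm_apply_apply, aug_apply, map_sum]
  refine Finset.sum_congr rfl (fun g _ => ?_)
  rw [monomial_mul]
  by_cases h0 : c g = 0
  · simp [h0]
  rw [tsub_add_cancel_of_le (h g h0)]

theorem lft_zero (i : ℕ) (b : σ →₀ ℕ) : Rs.lft i b 0 = 0 := by
  ext1 g; simp [lft]

theorem exists_bound (i : ℕ) (c : Rs.F i → k) : ∃ b, SupIn (Rs.deg i) (Set.Iic b) c :=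
  ⟨∑ g, Rs.deg i g, fun g _ => Finset.single_le_sum (f := Rs.deg i) (fun _ _ => zero_le)
    (Finset.mem_univ g)⟩

theorem ext_zero (i : ℕ) (b : σ →₀ ℕ) : Rs.ext i b 0 = 0 := by
  funext g; simp [ext]

/-- the scalar complex -/
def toSCx : SCx k σ (fun b => monomial b (1 : k) ∈ I) where
  F := Rs.F
  fin := Rs.finite
  deg := Rs.deg
  del := Rs.del
  eps := Rs.aug
  del_lt := by
    intro i c g' h
    rw [del_apply] at h
    obtain ⟨g, _, hg⟩ := Finset.exists_ne_zero_of_sum_ne_zero h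
    exact ⟨g, left_ne_zero_of_mul hg, Rs.sc_lt i g g' (right_ne_zero_of_mul hg)⟩
  dd := by
    intro i c
    obtain ⟨b, hb⟩ := Rs.exists_bound (i + 2) c
    rw [← Rs.ext_lft _ b c hb]
    rw [← ext_d, ← ext_d]
    have : Rs.d (i + 1) (Rs.lft (i + 2) b c) ∈ LinearMap.ker (Rs.d i) := by
      rw [Rs.exact_d i]; exact ⟨_, rfl⟩
    rw [LinearMap.mem_ker.1 this, ext_zero]
  ed := by
    intro c
    obtain ⟨b, hb⟩ := Rs.exists_bound 1 c
    rw [← Rs.ext_lft _ b c hb]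
    rw [← ext_d, ← coeff_eps]
    have : Rs.d 0 (Rs.lft 1 b c) ∈ LinearMap.ker Rs.eps := by
      rw [Rs.exact_eps]; exact ⟨_, rfl⟩
    rw [LinearMap.mem_ker.1 this, coeff_zero]
  ex0 := by
    intro b z hz h0
    have : Rs.lft 0 b z ∈ LinearMap.ker Rs.eps := by
      rw [LinearMap.mem_ker, eps_lft _ _ _ hz, h0, map_zero]
    rw [Rs.exact_eps] at this
    obtain ⟨f, hf⟩ := this
    refine ⟨Rs.ext 1 b f, Rs.ext_sup _ _ _, ?_⟩
    rw [← ext_d, hf, ext_lft _ _ _ _ hz]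
  ex := by
    intro i b z hz h0
    have : Rs.lft (i + 1) b z ∈ LinearMap.ker (Rs.d i) := by
      rw [LinearMap.mem_ker, d_lft _ _ _ _ hz, h0, lft_zero]
    rw [Rs.exact_d] at this
    obtain ⟨f, hf⟩ := this
    refine ⟨Rs.ext (i + 2) b f, Rs.ext_sup _ _ _, ?_⟩
    rw [← ext_d, hf, ext_lft _ _ _ _ hz]
  epsU := by
    intro b hb
    have : monomial b (1 : k) ∈ LinearMap.range Rs.eps := by rw [Rs.range_eps]; exact hb
    obtain ⟨f, hf⟩ := this
    refine ⟨Rs.ext 0 b f, Rs.ext_sup _ _ _, ?_⟩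
    rw [← coeff_eps, hf]; simp
  epsN := by
    intro b z hz hb
    by_contra h0
    apply hb
    have h1 : monomial b (Rs.aug z) ∈ I := by
      rw [← eps_lft _ _ _ hz]
      have : Rs.eps (Rs.lft 0 b z) ∈ LinearMap.range Rs.eps := ⟨_, rfl⟩
      rw [Rs.range_eps] at this
      exact this
    have h2 := I.mul_mem_left (C (Rs.aug z)⁻¹) h1
    rwa [C_mul_monomial, inv_mul_cancel₀ h0] at h2

end MinFreeRes

theorem prod_X_eq {σ k : Type} [Field k] (T : Finset σ) :
    (∏ e ∈ T, X e : MvPolynomial σ k) = monomial (SCx.ind T) 1 := by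
  rw [monomial_eq, map_one, one_mul, Finsupp.prod_of_support_subset (s := T)]
  · refine Finset.prod_congr rfl (fun e he => ?_)
    simp [SCx.ind_apply, he]
  · rw [SCx.ind_support]
  · simp

theorem mem_span_iff {σ k : Type} [Field k] (P : Finset σ → Prop) (b : σ →₀ ℕ) :
    monomial b (1 : k) ∈ Ideal.span {p : MvPolynomial σ k | ∃ T, P T ∧ p = ∏ e ∈ T, X e} ↔
      ∃ T, P T ∧ T ⊆ b.support := by
  have : {p : MvPolynomial σ k | ∃ T, P T ∧ p = ∏ e ∈ T, X e} =
      (fun s => monomial s (1 : k)) '' (SCx.ind '' {T | P T}) := by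
    ext p
    simp only [Set.mem_ofPred_eq, Set.mem_image, exists_exists_and_eq_and, prod_X_eq]
    constructor
    · rintro ⟨T, h, rfl⟩; exact ⟨T, h, rfl⟩
    · rintro ⟨T, h, rfl⟩; exact ⟨T, h, rfl⟩
  rw [this, mem_ideal_span_monomial_image]
  have hs : (monomial b (1 : k)).support = {b} := by
    rw [support_monomial, if_neg one_ne_zero]
  simp only [hs, Finset.mem_singleton, forall_eq, Set.mem_image, Set.mem_ofPred_eq,
    exists_exists_and_eq_and]
  refine exists_congr (fun T => and_congr_right (fun _ => ?_))
  constructor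
  · intro h a ha
    have := h a
    rw [SCx.ind_apply, if_pos ha] at this
    simp; omega
  · intro h a
    rw [SCx.ind_apply]
    split_ifs with ha
    · have := h ha
      simp at this; omega
    · simp

namespace Multigraph

variable {V E : Type} (G : Multigraph V E)

/-- no nonempty set of darts all of whose tails are heads -/
def NC (D : Finset (E × Bool)) : Prop :=
  ∀ A ⊆ D, A.Nonempty → ∃ d ∈ A, ∀ c ∈ A, G.dhead c ≠ G.dtail d

theorem NC.mono {G : Multigraph V E} {D D' : Finset (E × Bool)} (h : G.NC D) (hD : D' ⊆ D) :
    G.NC D' := fun A hA => h A (hA.trans hD)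

theorem nc_of_acyclic {D : Finset (E × Bool)} (h : G.Acyclic D) : G.NC D := by
  intro A hA hne
  by_contra hcon
  push Not at hcon
  choose p hp hp' using hcon
  let f : A → A := fun d => ⟨p d.1 d.2, hp d.1 d.2⟩
  have hf : ∀ d : A, G.dhead (f d).1 = G.dtail d.1 := fun d => hp' d.1 d.2
  obtain ⟨a, ha⟩ := hne
  obtain ⟨m, n, hmn, he⟩ := Finite.exists_ne_map_eq_of_infinite (fun n : ℕ => f^[n] ⟨a, ha⟩)
  have : ∃ x : A, 0 < Function.minimalPeriod f x := by
    wlog hlt : m < n generalizing m n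
    · exact this n m hmn.symm he.symm (by omega)
    refine ⟨f^[m] ⟨a, ha⟩, Function.IsPeriodicPt.minimalPeriod_pos (n := n - m) (by omega) ?_⟩
    unfold Function.IsPeriodicPt Function.IsFixedPt
    rw [← Function.iterate_add_apply, Nat.sub_add_cancel hlt.le]
    exact he.symm
  obtain ⟨x, hx⟩ := this
  set n0 := Function.minimalPeriod f x with hn0
  have hper : f^[n0] x = x := Function.iterate_minimalPeriod
  let l : List (E × Bool) := ((List.range n0).map (fun i => (f^[i] x).1)).reverse
  refine h l ?_ ⟨?_, ?_, ?_, ?_⟩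
  · intro d hd
    simp only [l, List.mem_reverse, List.mem_map] at hd
    obtain ⟨i, _, rfl⟩ := hd
    exact hA (f^[i] x).2
  · simp [l]; omega
  · simp only [l, List.nodup_reverse]
    apply List.Nodup.map_on _ List.nodup_range
    intro i hi j hj hij
    simp only [List.mem_range] at hi hj
    exact Function.iterate_injOn_Iio_minimalPeriod hi hj (Subtype.ext hij)
  · show List.IsChain _ _
    simp only [l]
    rw [List.isChain_reverse, List.isChain_map, List.isChain_iff_getElem]
    intro i hi
    simp only [List.getElem_range, Function.iterate_succ_apply', flip]
    exact hf _
  · intro hl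
    simp only [l, List.getLast_reverse, List.head_reverse, List.head_map, List.getLast_map,
      List.head_range, List.getLast_range]
    rw [← hf, ← Function.iterate_succ_apply' f]
    have : (n0 - 1).succ = n0 := by omega
    rw [this, hper]; rfl

theorem acyclic_of_nc {D : Finset (E × Bool)} (h : G.NC D) : G.Acyclic D := by
  rintro l hl ⟨hne, _, hch, hlast⟩
  obtain ⟨d, hd, hd'⟩ := h l.toFinset (by intro d hd; exact hl d (by simpa using hd))
    (by simpa using hne)
  simp only [List.mem_toFinset] at hd hd'
  have hch' : List.IsChain (fun d d' => G.dhead d = G.dtail d') l := hch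
  rw [List.isChain_iff_getElem] at hch'
  obtain ⟨j, hj, rfl⟩ := List.mem_iff_getElem.1 hd
  cases j with
  | zero =>
    apply hd' _ (List.getLast_mem hne)
    rw [hlast hne, List.head_eq_getElem]
  | succ j => exact hd' _ (List.getElem_mem (by omega)) (hch' j hj)

theorem reach_mono {P Q : Finset (E × Bool)} (h : P ⊆ Q) {u v : V} (hr : G.ReachIn P u v) :
    G.ReachIn Q u v := by
  refine Relation.ReflTransGen.mono ?_ u v hr
  rintro a b ⟨d, hd, h'⟩
  exact ⟨d, h hd, h'⟩

/-- everything is reachable -/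
def Rch (q : V) (D : Finset (E × Bool)) : Prop := ∀ v, G.ReachIn D q v

theorem rch_indart {q : V} {D : Finset (E × Bool)} (h : G.Rch q D) {v : V} (hv : v ≠ q) :
    ∃ d ∈ D, G.dhead d = v := by
  rcases Relation.ReflTransGen.cases_tail (h v) with h | ⟨_, _, d, hd, _, h⟩
  · exact absurd h hv
  · exact ⟨d, hd, h⟩

theorem rch_of_indart {q : V} {D D' : Finset (E × Bool)} (h : G.NC D) (hD : D' ⊆ D)
    (hin : ∀ v, v ≠ q → ∃ d ∈ D', G.dhead d = v) : G.Rch q D' := by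
  intro v
  by_contra hv
  let A := D'.filter (fun d => ¬ G.ReachIn D' q (G.dhead d))
  have hq : ∀ w, ¬ G.ReachIn D' q w → w ≠ q := by
    rintro w hw rfl
    exact hw Relation.ReflTransGen.refl
  have hne : A.Nonempty := by
    obtain ⟨d, hd, rfl⟩ := hin v (hq v hv)
    exact ⟨d, by simp [A, hd, hv]⟩
  obtain ⟨d, hd, hd'⟩ := h A ((Finset.filter_subset _ _).trans hD) hne
  simp only [A, Finset.mem_filter] at hd hd'
  have ht : ¬ G.ReachIn D' q (G.dtail d) := fun h =>
    hd.2 (h.tail ⟨d, hd.1, rfl, rfl⟩)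
  obtain ⟨c, hc, hc'⟩ := hin _ (hq _ ht)
  exact hd' c ⟨hc, hc' ▸ ht⟩ hc'

theorem rch_erase [DecidableEq E] {q : V} {S P : Finset (E × Bool)} {e : E × Bool} (hP : P ⊆ S)
    (he : e ∉ P) (hr : G.ReachIn P q (G.dhead e)) : G.Rch q S ↔ G.Rch q (S.erase e) := by
  have hP' : P ⊆ S.erase e := Finset.subset_erase.2 ⟨hP, he⟩
  refine ⟨fun h v => ?_, fun h v => G.reach_mono (Finset.erase_subset _ _) (h v)⟩
  have hv := h v
  induction hv with
  | refl => exact Relation.ReflTransGen.refl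
  | tail _ hst ih =>
    obtain ⟨d, hd, h1, rfl⟩ := hst
    by_cases hde : d = e
    · subst hde; exact G.reach_mono hP' hr
    · exact ih.tail ⟨d, Finset.mem_erase.2 ⟨hde, hd⟩, h1, rfl⟩

theorem exists_reach_head [DecidableEq E] {q : V} {D A : Finset (E × Bool)}
    (hA : ∀ d ∈ A, ∃ c ∈ A, G.dhead c = G.dtail d) {v : V} (h : G.ReachIn D q v) :
    G.ReachIn (D \ A) q v ∨ ∃ c ∈ A, G.ReachIn (D \ A) q (G.dhead c) := by
  induction h with
  | refl => exact Or.inl Relation.ReflTransGen.refl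
  | tail _ hst ih =>
    rcases ih with ih | ih
    · obtain ⟨d, hd, h1, rfl⟩ := hst
      by_cases hdA : d ∈ A
      · obtain ⟨c, hc, hc'⟩ := hA d hdA
        exact Or.inr ⟨c, hc, by rw [hc', h1]; exact ih⟩
      · exact Or.inl (ih.tail ⟨d, Finset.mem_sdiff.2 ⟨hd, hdA⟩, h1, rfl⟩)
    · exact Or.inr ih

/-- reachable in a given number of steps -/
def RN (q : V) (D : Finset (E × Bool)) : ℕ → V → Prop
  | 0, v => v = q
  | m + 1, v => ∃ d ∈ D, G.dhead d = v ∧ RN q D m (G.dtail d)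

theorem exists_rn {q : V} {D : Finset (E × Bool)} (h : G.Rch q D) (v : V) : ∃ m, G.RN q D m v := by
  have hv := h v
  induction hv with
  | refl => exact ⟨0, rfl⟩
  | tail _ hst ih =>
    obtain ⟨d, hd, rfl, rfl⟩ := hst
    obtain ⟨m, hm⟩ := ih
    exact ⟨m + 1, d, hd, rfl, hm⟩

variable [Fintype V] [DecidableEq V] [DecidableEq E] 

theorem exists_tree {q : V} {D : Finset (E × Bool)} (h : G.Rch q D) :
    ∃ T ⊆ D, T.card = Fintype.card V - 1 ∧ G.NC T ∧ G.Rch q T ∧ ∀ d ∈ T, G.dhead d ≠ q := by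
  let ρ : V → ℕ := fun v => Nat.find (G.exists_rn h v)
  have hpar : ∀ v, v ≠ q → ∃ d ∈ D, G.dhead d = v ∧ ρ (G.dtail d) < ρ v := by
    intro v hv
    have hs : G.RN q D (ρ v) v := Nat.find_spec (G.exists_rn h v)
    cases hm : ρ v with
    | zero => rw [hm] at hs; exact absurd hs hv
    | succ m =>
      rw [hm] at hs
      obtain ⟨d, hd, h1, h2⟩ := hs
      exact ⟨d, hd, h1, Nat.lt_succ_of_le (Nat.find_min' _ h2)⟩
  by_cases hEmp : Nonempty E
  swap
  · refine ⟨∅, by simp, ?_, ?_, ?_, by simp⟩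
    · have : ∀ v, v = q := by
        intro v
        by_contra hv
        obtain ⟨d, _⟩ := hpar v hv
        exact hEmp ⟨d.1⟩
      have : Fintype.card V ≤ 1 := Fintype.card_le_one_iff.2 (fun a b => by rw [this a, this b])
      simp; omega
    · intro A hA hne
      rw [Finset.subset_empty.1 hA] at hne
      simp at hne
    · intro v
      have : v = q := by
        by_contra hv
        obtain ⟨d, _⟩ := hpar v hv
        exact hEmp ⟨d.1⟩
      rw [this]; exact Relation.ReflTransGen.refl
  have hE : Nonempty (E × Bool) := ⟨(hEmp.some, true)⟩
  choose! p hpD hph hpr using hpar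
  let T := (Finset.univ.erase q).image p
  have hT : ∀ d, d ∈ T ↔ ∃ v, v ≠ q ∧ p v = d := by
    intro d; simp [T]
  refine ⟨T, ?_, ?_, ?_, ?_, ?_⟩
  · intro d hd
    obtain ⟨v, hv, rfl⟩ := (hT d).1 hd
    exact hpD v hv
  · rw [Finset.card_image_of_injOn]
    · rw [Finset.card_erase_of_mem (Finset.mem_univ _), Finset.card_univ]
    · intro v hv w hw hvw
      simp at hv hw
      rw [← hph v hv, ← hph w hw, hvw]
  · intro A hA hne
    obtain ⟨d, hd, hmin⟩ := Finset.exists_min_image A (fun d => ρ (G.dhead d)) hne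
    refine ⟨d, hd, fun c hc hcd => ?_⟩
    obtain ⟨v, hv, rfl⟩ := (hT d).1 (hA hd)
    have h1 := hmin c hc
    have h2 := hpr v hv
    simp only [hcd, hph v hv] at h1
    omega
  · intro v
    induction hm : ρ v using Nat.strong_induction_on generalizing v with
    | _ m ih =>
      by_cases hv : v = q
      · rw [hv]; exact Relation.ReflTransGen.refl
      · exact (ih _ (hm ▸ hpr v hv) _ rfl).tail ⟨p v, (hT _).2 ⟨v, hv, rfl⟩, rfl, hph v hv⟩
  · intro d hd
    obtain ⟨v, hv, rfl⟩ := (hT d).1 hd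
    rw [hph v hv]; exact hv

/-- the orientations counted -/
def Good (q : V) (D : Finset (E × Bool)) : Prop :=
  G.NC D ∧ G.Rch q D ∧ ∀ d ∈ D, G.dhead d ≠ q

theorem ost_iff [Fintype E] (q : V) (i : ℕ) (T : Finset (E × Bool)) :
    G.IsOrientedSpanningTree q i T ↔ T.card = Fintype.card V - 1 + i ∧ G.Good q T :=
  ⟨fun ⟨h1, h2, h3, h4⟩ => ⟨h1, G.nc_of_acyclic h2, h3, h4⟩,
    fun ⟨h1, h2, h3, h4⟩ => ⟨h1, G.acyclic_of_nc h2, h3, h4⟩⟩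

theorem Good.sub {G : Multigraph V E} {q : V} {D D' : Finset (E × Bool)} (h : G.Good q D)
    (hD : D' ⊆ D) (hr : G.Rch q D') : G.Good q D' :=
  ⟨h.1.mono hD, hr, fun d hd => h.2.2 d (hD hd)⟩

theorem Good.image_head {G : Multigraph V E} {q : V} {D : Finset (E × Bool)} (h : G.Good q D) :
    D.image G.dhead = Finset.univ.erase q := by
  ext v
  simp only [Finset.mem_image, Finset.mem_erase, Finset.mem_univ, and_true]
  constructor
  · rintro ⟨d, hd, rfl⟩; exact h.2.2 d hd
  · intro hv; exact G.rch_indart h.2.1 hv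

theorem Good.card_head {G : Multigraph V E} {q : V} {D : Finset (E × Bool)} (h : G.Good q D) :
    (D.image G.dhead).card = Fintype.card V - 1 := by
  rw [h.image_head, Finset.card_erase_of_mem (Finset.mem_univ _), Finset.card_univ]

theorem good_sum (q : V) (m : ℕ) : ∀ D : Finset (E × Bool), D.card = m → G.Good q D →
    ∑ D' ∈ D.powerset, (-1 : ℤ) ^ D'.card * (if G.Good q D' then 1 else 0) =
      (-1) ^ (Fintype.card V - 1) := by
  induction m with
  | zero =>
    intro D hD hG
    have h := hG.card_head
    rw [Finset.card_eq_zero] at hD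
    subst hD
    simp at h
    simp [hG, ← h]
  | succ m ih =>
    intro D hD hG
    by_cases hinj : Set.InjOn G.dhead (D : Set (E × Bool))
    · have hc : D.card = Fintype.card V - 1 := by
        rw [← hG.card_head, Finset.card_image_of_injOn hinj]
      rw [Finset.sum_eq_single D]
      · simp [hG, hc]
      · intro D' hD' hne
        rw [if_neg, mul_zero]
        intro hG'
        apply hne
        apply Finset.eq_of_subset_of_card_le (Finset.mem_powerset.1 hD')
        rw [hc, ← hG'.card_head]
        exact Finset.card_image_le
      · simp
    · simp only [Set.InjOn, Finset.mem_coe] at hinj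
      push Not at hinj
      obtain ⟨e, he, f, hf, hef, hne⟩ := hinj
      have key : ∀ e f, G.dhead e = G.dhead f → e ≠ f → ∀ S ⊆ D, f ∈ S → e ∈ S →
          (G.Good q S ↔ G.Good q (S.erase e)) := by
        intro e f hef hne S hS hfS heS
        constructor
        · intro h
          refine h.sub (Finset.erase_subset _ _) ?_
          refine G.rch_of_indart hG.1 ((Finset.erase_subset _ _).trans hS) (fun v hv => ?_)
          obtain ⟨d, hd, hdv⟩ := G.rch_indart h.2.1 hv
          by_cases hde : d = e
          · exact ⟨f, Finset.mem_erase.2 ⟨hne.symm, hfS⟩, by rw [← hef, ← hde, hdv]⟩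
          · exact ⟨d, Finset.mem_erase.2 ⟨hde, hd⟩, hdv⟩
        · intro h
          exact hG.sub hS (fun v => G.reach_mono (Finset.erase_subset _ _) (h.2.1 v))
      have hGf : G.Good q (D.erase f) := (key f e hef.symm hne.symm D subset_rfl he hf).1 hG
      have hsum1 := ih (D.erase f) (by rw [Finset.card_erase_of_mem hf, hD]; rfl) hGf
      rw [← Finset.insert_erase hf, Finset.sum_powerset_insert (by simp), hsum1]
      have he1 : e ∈ D.erase f := Finset.mem_erase.2 ⟨hne, he⟩
      rw [← Finset.insert_erase he1, Finset.sum_powerset_insert (by simp),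
        ← Finset.sum_add_distrib, Finset.sum_eq_zero, add_zero]
      intro t ht
      rw [Finset.mem_powerset] at ht
      have het : e ∉ t := fun h => by simpa using ht h
      have hft : f ∉ t := fun h => by simpa using ht h
      have hk := key e f hef hne (insert f (insert e t)) (by
        intro x hx
        simp only [Finset.mem_insert] at hx
        rcases hx with rfl | rfl | hx
        · exact hf
        · exact he
        · exact Finset.mem_of_mem_erase (Finset.mem_of_mem_erase (ht hx))) (by simp) (by simp)
      have h2 : (insert f (insert e t)).erase e = insert f t := by
        rw [Finset.insert_comm, Finset.erase_insert]
        simp [hne, het]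
      rw [h2] at hk
      rw [Finset.card_insert_of_notMem (s := insert e t) (by simp [hft, hne.symm]),
        Finset.card_insert_of_notMem hft, Finset.card_insert_of_notMem het]
      simp only [hk]
      ring

end Multigraph

namespace SCx

variable {k : Type} [Field k] {σ : Type} {U : (σ →₀ ℕ) → Prop} (C : SCx k σ U)

theorem van_extend [DecidableEq σ] (A : Finset σ)
    (h : ∀ S, A ⊆ S → ∀ i, C.Van i (Set.Iic (ind S)) (NN (ind S) A)) (A' : Finset σ) :
    Disjoint A A' → ∀ S, A ∪ A' ⊆ S → ∀ i, C.Van i (Set.Iic (ind S)) (NN (ind S) (A ∪ A')) := by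
  induction A' using Finset.induction_on with
  | empty =>
    intro _ S hS i
    rw [Finset.union_empty] at hS ⊢
    exact h S hS i
  | insert e A' he ih =>
    intro hd S hS i
    rw [Finset.disjoint_insert_right] at hd
    rw [Finset.union_insert] at hS ⊢
    have heA : e ∉ A ∪ A' := by simp [hd.1, he]
    have heS : e ∈ S := hS (by simp)
    have hS' : A ∪ A' ⊆ S := (Finset.subset_insert _ _).trans hS
    apply C.van_insert _ _ _ (by simp [ind_apply, heS]) heA
    · exact ih hd.2 S hS' i
    · rintro j -
      rw [ind_sub_single]
      exact ih hd.2 _ (Finset.subset_erase.2 ⟨hS', heA⟩) j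

theorem van_full [DecidableEq σ] (A : Finset σ)
    (h : ∀ S, A ⊆ S → ∃ e ∈ A, ∀ X ⊆ A.erase e, (U (ind (S \ X)) ↔ U (ind ((S \ X).erase e))))
    (S : Finset σ) (hS : A ⊆ S) (i : ℕ) : C.Van i (Set.Iic (ind S)) (NN (ind S) S) := by
  have h1 : ∀ S, A ⊆ S → ∀ i, C.Van i (Set.Iic (ind S)) (NN (ind S) A) := by
    intro S hS i
    obtain ⟨e, he, hX⟩ := h S hS
    have := C.van_Z e (A.erase e) (by simp) (ind S) (by simp [ind_apply, hS he])
      (by intro a ha; simp [ind_apply, hS (Finset.mem_of_mem_erase ha)])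
      (by intro X hX'; rw [ind_sub, ind_sub_single]; exact hX X hX') i
    rwa [Finset.insert_erase he] at this
  have := C.van_extend A h1 (S \ A) Finset.disjoint_sdiff S
    (by rw [Finset.union_sdiff_of_subset hS]) i
  rwa [Finset.union_sdiff_of_subset hS] at this

end SCx

namespace Multigraph

variable {V E : Type} (G : Multigraph V E) [Fintype V] [Fintype E] [DecidableEq V] [DecidableEq E]

section dart

variable {k : Type} [Field k] {q : V} {U : (E × Bool →₀ ℕ) → Prop} (C : SCx k (E × Bool) U)
  (hU : ∀ b, U b ↔ G.Rch q b.support)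

include hU

theorem dart_U_ind (S : Finset (E × Bool)) : U (SCx.ind S) ↔ G.Rch q S := by
  rw [hU, SCx.ind_support]

theorem dart_bet_good (i : ℕ) (D : Finset (E × Bool)) (h : C.bet i D ≠ 0) : G.Good q D := by
  by_contra hG
  apply h
  apply C.bet_zero
  by_cases hr : G.Rch q D
  swap
  · by_cases hD : D = ∅
    · subst hD
      exact C.van_empty _ _ (fun _ => by rw [G.dart_U_ind hU]; exact hr)
    · obtain ⟨e, he⟩ := Finset.nonempty_iff_ne_empty.2 hD
      have := C.van_Z e (D.erase e) (by simp) (SCx.ind D) (by simp [SCx.ind_apply, he])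
        (by intro a ha; simp [SCx.ind_apply, Finset.mem_of_mem_erase ha])
        (by
          intro X hX
          rw [SCx.ind_sub, SCx.ind_sub_single, G.dart_U_ind hU, G.dart_U_ind hU]
          have h1 : ∀ S ⊆ D, ¬ G.Rch q S := fun S hS h =>
            hr (fun v => G.reach_mono hS (h v))
          exact iff_of_false (h1 _ Finset.sdiff_subset)
            (h1 _ ((Finset.erase_subset _ _).trans Finset.sdiff_subset))) i
      rwa [Finset.insert_erase he] at this
  by_cases hq : ∃ d ∈ D, G.dhead d = q
  · obtain ⟨e, he, heq⟩ := hq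
    refine C.van_full {e} ?_ D (by simpa using he) i
    intro S hS
    refine ⟨e, by simp, fun X _ => ?_⟩
    rw [G.dart_U_ind hU, G.dart_U_ind hU]
    exact G.rch_erase (P := ∅) (by simp) (by simp) (by rw [heq]; exact Relation.ReflTransGen.refl)
  have hnc : ¬ G.NC D := fun h => hG ⟨h, hr, fun d hd hdq => hq ⟨d, hd, hdq⟩⟩
  unfold NC at hnc
  push Not at hnc
  obtain ⟨A, hAD, hne, hA⟩ := hnc
  refine C.van_full A ?_ D hAD i
  intro S hS
  simp only [G.dart_U_ind hU]
  by_cases hrS : G.Rch q S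
  · have : ∃ c ∈ A, G.ReachIn (S \ A) q (G.dhead c) := by
      obtain ⟨d, hd⟩ := hne
      rcases G.exists_reach_head hA (hrS (G.dhead d)) with h | h
      · exact ⟨d, hd, h⟩
      · exact h
    obtain ⟨c, hc, hr⟩ := this
    refine ⟨c, hc, fun X hX => ?_⟩
    exact G.rch_erase (P := S \ A)
      (Finset.sdiff_subset_sdiff subset_rfl (hX.trans (Finset.erase_subset _ _)))
      (by simp [hc]) hr
  · obtain ⟨c, hc⟩ := hne
    have h1 : ∀ S' ⊆ S, ¬ G.Rch q S' := fun S' hS' h =>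
      hrS (fun v => G.reach_mono hS' (h v))
    exact ⟨c, hc, fun X _ => iff_of_false (h1 _ Finset.sdiff_subset)
      (h1 _ ((Finset.erase_subset _ _).trans Finset.sdiff_subset))⟩

theorem dart_lin (i : ℕ) (D : Finset (E × Bool)) (h : C.bet i D ≠ 0) :
    D.card = Fintype.card V - 1 + i := by
  have hG := G.dart_bet_good C hU i D h
  by_contra hc
  apply h
  apply C.bet_zero
  refine C.van_main D (fun B => (B.image G.dhead).card) (Fintype.card V - 1) ?_ ?_ D D
    subset_rfl subset_rfl i (by simp; omega)
  · intro B e heB hBD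
    by_cases hh : G.dhead e ∈ B.image G.dhead
    · right
      intro S hS hSD
      rw [G.dart_U_ind hU, G.dart_U_ind hU]
      refine ⟨fun h => ?_, fun h v => G.reach_mono (Finset.erase_subset _ _) (h v)⟩
      refine G.rch_of_indart hG.1 ((Finset.erase_subset _ _).trans hSD) (fun v hv => ?_)
      obtain ⟨d, hd, hdv⟩ := G.rch_indart h hv
      obtain ⟨f, hf, hfe⟩ := Finset.mem_image.1 hh
      by_cases hde : d = e
      · exact ⟨f, Finset.mem_erase.2 ⟨fun h => heB (h ▸ hf), hS (by simp [hf])⟩,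
          by rw [hfe, ← hde, hdv]⟩
      · exact ⟨d, Finset.mem_erase.2 ⟨hde, hd⟩, hdv⟩
    · left
      rw [Finset.image_insert, Finset.card_insert_of_notMem hh]
  · intro S hS hUS
    rw [G.dart_U_ind hU] at hUS
    exact (hG.sub hS hUS).card_head

theorem dart_btot (D : Finset (E × Bool)) : C.btot D = if G.Good q D then 1 else 0 := by
  have hz : ∀ D, ¬ G.Good q D → C.btot D = 0 := by
    intro D hD
    apply Finset.sum_eq_zero
    intro i _
    by_contra h
    exact hD (G.dart_bet_good C hU i D h)
  induction D using Finset.strongInduction with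
  | H D ih =>
    by_cases hG : G.Good q D
    swap
    · rw [if_neg hG, hz D hG]
    have h1 := C.euler_btot (Fintype.card V - 1) (G.dart_lin C hU) D
    rw [if_pos ((G.dart_U_ind hU D).2 hG.2.1), mul_one, ← G.good_sum q _ D rfl hG] at h1
    rw [← Finset.add_sum_erase _ _ (Finset.mem_powerset_self D),
      ← Finset.add_sum_erase D.powerset _ (Finset.mem_powerset_self D)] at h1
    have h2 : ∑ D' ∈ D.powerset.erase D, (-1 : ℤ) ^ D'.card * (C.btot D' : ℤ) =
        ∑ D' ∈ D.powerset.erase D, (-1 : ℤ) ^ D'.card * (if G.Good q D' then 1 else 0) := by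
      refine Finset.sum_congr rfl (fun D' hD' => ?_)
      rw [Finset.mem_erase, Finset.mem_powerset] at hD'
      rw [ih D' (Finset.ssubset_iff_subset_ne.2 ⟨hD'.2, hD'.1⟩)]
      push_cast
      rfl
    rw [h2] at h1
    have h3 := add_right_cancel h1
    have h4 := mul_left_cancel₀ (pow_ne_zero _ (by norm_num : (-1 : ℤ) ≠ 0)) h3
    exact_mod_cast h4

theorem dart_bet (i : ℕ) (D : Finset (E × Bool)) :
    C.bet i D = if G.IsOrientedSpanningTree q i D then 1 else 0 := by
  rw [C.bet_eq _ (G.dart_lin C hU), G.dart_btot C hU]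
  simp only [ost_iff]
  split_ifs <;> tauto

include C

/-- the key signed count -/
theorem dart_sum (Y : Finset (E × Bool)) :
    ∑ D ∈ Y.powerset, (-1 : ℤ) ^ D.card * (if G.Good q D then 1 else 0) =
      (-1) ^ (Fintype.card V - 1) * (if G.Rch q Y then 1 else 0) := by
  have := C.euler_btot (Fintype.card V - 1) (G.dart_lin C hU) Y
  simp only [G.dart_btot C hU, G.dart_U_ind hU] at this
  push_cast at this
  exact this

end dart

end Multigraph

namespace SCx

theorem card_F {k : Type} [Field k] {σ : Type} {U : (σ →₀ ℕ) → Prop} (C : SCx k σ U)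
    [Fintype σ] [DecidableEq σ]
    (hU : ∀ b b' : σ →₀ ℕ, b.support = b'.support → (U b ↔ U b')) (i : ℕ) :
    Nat.card (C.F i) = ∑ S : Finset σ, C.bet i S := by
  rw [← Finset.powerset_univ, ← cnt_eq, cnt]
  refine Nat.card_congr (Equiv.subtypeUnivEquiv (fun g => ?_)).symm
  rw [C.sqfree hU i g]
  exact ind_le_ind.2 (Finset.subset_univ _)

end SCx

namespace Multigraph

variable {V E : Type} (G : Multigraph V E)

/-- all darts over a set of edges -/
def dd (S : Finset E) : Finset (E × Bool) := S ×ˢ (Finset.univ : Finset Bool)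

theorem mem_dd {S : Finset E} {d : E × Bool} : d ∈ dd S ↔ d.1 ∈ S := by
  simp [dd]

theorem dd_symm {S : Finset E} {u v : V} (h : G.ReachIn (dd S) u v) : G.ReachIn (dd S) v u := by
  have hs : ∀ a b, (∃ d ∈ dd S, G.dtail d = a ∧ G.dhead d = b) →
      (∃ d ∈ dd S, G.dtail d = b ∧ G.dhead d = a) := by
    rintro a b ⟨⟨e, x⟩, hd, h1, h2⟩
    refine ⟨(e, !x), ?_, ?_, ?_⟩
    · rw [mem_dd] at hd ⊢; exact hd
    · rw [← h2]; cases x <;> simp [dtail, dhead]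
    · rw [← h1]; cases x <;> simp [dtail, dhead]
  induction h with
  | refl => exact Relation.ReflTransGen.refl
  | tail _ hst ih => exact Relation.ReflTransGen.head (hs _ _ hst) ih

theorem nc_not_both {D : Finset (E × Bool)} (h : G.NC D) (e : E) :
    ¬ ((e, true) ∈ D ∧ (e, false) ∈ D) := by
  rintro ⟨h1, h2⟩
  obtain ⟨d, hd, hd'⟩ := h {(e, true), (e, false)} (by
    intro x hx; simp at hx; rcases hx with rfl | rfl <;> assumption) (by simp)
  simp at hd
  rcases hd with rfl | rfl
  · exact hd' (e, false) (by simp) (by simp [dhead, dtail])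
  · exact hd' (e, true) (by simp) (by simp [dhead, dtail])

theorem nc_inj {D : Finset (E × Bool)} (h : G.NC D) : Set.InjOn Prod.fst (D : Set (E × Bool)) := by
  rintro ⟨e, x⟩ h1 ⟨e', y⟩ h2 he
  have : e = e' := he
  subst this
  have := G.nc_not_both h e
  cases x <;> cases y <;> simp_all

/-- functions constant along the edges of `B` -/
def Wc (B : Finset E) : Submodule ℚ (V → ℚ) where
  carrier := {f | ∀ e ∈ B, f (G.fst e) = f (G.snd e)}
  add_mem' h h' e he := by simp [h e he, h' e he]
  zero_mem' e he := rfl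
  smul_mem' a f h e he := by simp [h e he]

variable [Fintype V] [Fintype E] [DecidableEq V] [DecidableEq E]

theorem st_iff (q : V) (T : Finset E) :
    G.IsSpanningTree T ↔ T.card = Fintype.card V - 1 ∧ G.Rch q (dd T) := by
  have hr : (fun a b => ∃ d : E × Bool, d.1 ∈ T ∧ G.dtail d = a ∧ G.dhead d = b) =
      (fun a b => ∃ d ∈ dd T, G.dtail d = a ∧ G.dhead d = b) := by
    funext a b; simp only [mem_dd]
  unfold IsSpanningTree
  rw [hr]
  refine and_congr_right (fun _ => ⟨fun h v => h q v, fun h u v => ?_⟩)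
  exact Relation.ReflTransGen.trans (G.dd_symm (h u)) (h v)

theorem card_fst {D : Finset (E × Bool)} (h : G.NC D) : (D.image Prod.fst).card = D.card :=
  Finset.card_image_of_injOn (G.nc_inj h)

theorem sub_dd {D : Finset (E × Bool)} {S : Finset E} : D.image Prod.fst ⊆ S ↔ D ⊆ dd S := by
  rw [Finset.image_subset_iff]
  exact forall₂_congr (fun d _ => mem_dd.symm)

theorem exists_st (q : V) (S : Finset E) :
    (∃ T, G.IsSpanningTree T ∧ T ⊆ S) ↔ G.Rch q (dd S) := by
  constructor
  · rintro ⟨T, hT, hTS⟩ v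
    exact G.reach_mono (fun d hd => mem_dd.2 (hTS (mem_dd.1 hd))) (((G.st_iff q T).1 hT).2 v)
  · intro h
    obtain ⟨T, hTD, hc, hnc, hr, _⟩ := G.exists_tree h
    refine ⟨T.image Prod.fst, (G.st_iff q _).2 ⟨?_, fun v => ?_⟩, sub_dd.2 hTD⟩
    · rw [G.card_fst hnc, hc]
    · exact G.reach_mono (sub_dd.1 subset_rfl) (hr v)

theorem exists_ost (q : V) (D : Finset (E × Bool)) :
    (∃ T, G.IsOrientedSpanningTree q 0 T ∧ T ⊆ D) ↔ G.Rch q D := by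
  constructor
  · rintro ⟨T, hT, hTS⟩ v
    exact G.reach_mono hTS (hT.2.2.1 v)
  · intro h
    obtain ⟨T, hTD, hc, hnc, hr, hq⟩ := G.exists_tree h
    exact ⟨T, (G.ost_iff q 0 T).2 ⟨hc, hnc, hr, hq⟩, hTD⟩

/-- graphic rank -/
def gr (B : Finset E) : ℕ := Fintype.card V - Module.finrank ℚ (G.Wc B)

theorem finrank_Wc_le (B : Finset E) : Module.finrank ℚ (G.Wc B) ≤ Fintype.card V := by
  have := Submodule.finrank_le (G.Wc B)
  rwa [Module.finrank_fintype_fun_eq_card] at this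

theorem gr_empty : G.gr ∅ = 0 := by
  have : G.Wc ∅ = ⊤ := by
    rw [eq_top_iff]
    intro f _ e he
    simp at he
  rw [gr, this, finrank_top, Module.finrank_fintype_fun_eq_card, Nat.sub_self]

theorem gr_insert (B : Finset E) (e : E)
    (h : ∃ f ∈ G.Wc B, f (G.fst e) ≠ f (G.snd e)) : G.gr (insert e B) = G.gr B + 1 := by
  let L : (V → ℚ) →ₗ[ℚ] ℚ := 
    LinearMap.proj (R := ℚ) (φ := fun _ : V => ℚ) (G.fst e) -
      LinearMap.proj (R := ℚ) (φ := fun _ : V => ℚ) (G.snd e)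
  have h1 := finrank_map_inf L (G.Wc B)
  have h2 : (G.Wc B).map L = ⊤ := by
    obtain ⟨f, hf, hne⟩ := h
    rw [eq_top_iff]
    rintro x -
    have hL : L f ≠ 0 := by simp [L]; exact sub_ne_zero.2 hne
    exact ⟨(x / L f) • f, (G.Wc B).smul_mem _ hf, by simp [hL]⟩
  have h3 : G.Wc B ⊓ LinearMap.ker L = G.Wc (insert e B) := by
    ext f
    constructor
    · rintro ⟨h1, h2⟩ x hx
      rcases Finset.mem_insert.1 hx with rfl | hx
      · exact sub_eq_zero.1 h2
      · exact h1 x hx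
    · intro h1
      exact ⟨fun x hx => h1 x (Finset.mem_insert_of_mem hx),
        sub_eq_zero.2 (h1 e (Finset.mem_insert_self _ _))⟩
  rw [h2, h3, finrank_top, Module.finrank_self] at h1
  have h4 := G.finrank_Wc_le B
  rw [gr, gr]
  omega

theorem wc_reach {B : Finset E} {f : V → ℚ} (hf : f ∈ G.Wc B) {u v : V}
    (h : G.ReachIn (dd B) u v) : f u = f v := by
  induction h with
  | refl => rfl
  | tail _ hst ih =>
    obtain ⟨⟨e, x⟩, hd, rfl, rfl⟩ := hst
    rw [ih]
    have := hf e (mem_dd.1 hd)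
    cases x <;> simp [dtail, dhead, this]

theorem reach_of_wc {B : Finset E} {e : E} (h : ∀ f ∈ G.Wc B, f (G.fst e) = f (G.snd e)) :
    G.ReachIn (dd B) (G.fst e) (G.snd e) := by
  have h1 := h (fun v => if G.ReachIn (dd B) (G.fst e) v then 1 else 0) (by
    intro x hx
    have h2 : G.ReachIn (dd B) (G.fst x) (G.snd x) :=
      Relation.ReflTransGen.single ⟨(x, true), mem_dd.2 hx, by simp [dtail], by simp [dhead]⟩
    have : G.ReachIn (dd B) (G.fst e) (G.fst x) ↔ G.ReachIn (dd B) (G.fst e) (G.snd x) :=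
      ⟨fun h => Relation.ReflTransGen.trans h h2,
        fun h => Relation.ReflTransGen.trans h (G.dd_symm h2)⟩
    simp only [this])
  by_contra hn
  have h0 : G.ReachIn (dd B) (G.fst e) (G.fst e) := Relation.ReflTransGen.refl
  simp [hn, h0] at h1

theorem gr_conn {q : V} {S : Finset E} (h : G.Rch q (dd S)) : G.gr S = Fintype.card V - 1 := by
  have : G.Wc S = Submodule.span ℚ {fun _ => (1 : ℚ)} := by
    ext f
    rw [Submodule.mem_span_singleton]
    constructor
    · intro hf
      refine ⟨f q, ?_⟩
      funext v
      simpa using G.wc_reach hf (h v)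
    · rintro ⟨a, rfl⟩ x _
      rfl
  rw [gr, this, finrank_span_singleton]
  intro h0
  have := congrFun h0 q
  simp at this

section und

variable {k : Type} [Field k] {q : V} {U : (E →₀ ℕ) → Prop} (C : SCx k E U)
  (hU : ∀ b, U b ↔ G.Rch q (dd b.support))

include hU

theorem und_U_ind (S : Finset E) : U (SCx.ind S) ↔ G.Rch q (dd S) := by
  rw [hU, SCx.ind_support]

theorem und_lin (i : ℕ) (S : Finset E) (h : C.bet i S ≠ 0) :
    S.card = Fintype.card V - 1 + i := by
  by_contra hc
  apply h
  apply C.bet_zero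
  refine C.van_main Finset.univ G.gr (Fintype.card V - 1) ?_ ?_ S S
    subset_rfl (Finset.subset_univ _) i (by rw [Finset.sdiff_self, G.gr_empty]; omega)
  · intro B e heB _
    by_cases hh : ∃ f ∈ G.Wc B, f (G.fst e) ≠ f (G.snd e)
    · exact Or.inl (G.gr_insert B e hh)
    · right
      push Not at hh
      have hr := G.reach_of_wc hh
      intro S hS _
      rw [G.und_U_ind hU, G.und_U_ind hU]
      have hsub : dd B ⊆ dd (S.erase e) := by
        intro d hd
        rw [mem_dd] at hd ⊢
        exact Finset.mem_erase.2 ⟨fun h => heB (h ▸ hd), hS (Finset.mem_insert_of_mem hd)⟩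
      have hr1 := G.reach_mono hsub hr
      have hr2 := G.dd_symm hr1
      refine ⟨fun h v => ?_, fun h v => G.reach_mono (fun d hd => ?_) (h v)⟩
      · have hv := h v
        induction hv with
        | refl => exact Relation.ReflTransGen.refl
        | tail _ hst ih =>
          obtain ⟨⟨x, y⟩, hd, rfl, rfl⟩ := hst
          by_cases hx : x = e
          · subst hx
            refine Relation.ReflTransGen.trans ih ?_
            cases y
            · exact hr2
            · exact hr1
          · exact ih.tail ⟨(x, y), mem_dd.2 (Finset.mem_erase.2 ⟨hx, mem_dd.1 hd⟩), rfl, rfl⟩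
      · rw [mem_dd] at hd ⊢
        exact Finset.mem_of_mem_erase hd
  · intro S _ hUS
    exact G.gr_conn ((G.und_U_ind hU S).1 hUS)

theorem und_btot
    (hsum : ∀ Y : Finset (E × Bool),
      ∑ D ∈ Y.powerset, (-1 : ℤ) ^ D.card * (if G.Good q D then 1 else 0) =
      (-1) ^ (Fintype.card V - 1) * (if G.Rch q Y then 1 else 0)) (S : Finset E) :
    C.btot S = (Finset.univ.filter
      (fun T : Finset (E × Bool) => G.Good q T ∧ T.image Prod.fst = S)).card := by
  let a : Finset E → ℕ := fun S => (Finset.univ.filter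
      (fun T : Finset (E × Bool) => G.Good q T ∧ T.image Prod.fst = S)).card
  have ha : ∀ S : Finset E, ∑ S' ∈ S.powerset, (-1 : ℤ) ^ S'.card * (a S' : ℤ) =
      (-1) ^ (Fintype.card V - 1) * (if G.Rch q (dd S) then 1 else 0) := by
    intro S
    rw [← hsum (dd S)]
    rw [← Finset.sum_fiberwise_of_maps_to (s := (dd S).powerset) (t := S.powerset)
      (g := fun D => D.image Prod.fst)]
    · refine Finset.sum_congr rfl (fun S' hS' => ?_)
      rw [Finset.mem_powerset] at hS'
      simp only [mul_ite, mul_one, mul_zero]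
      rw [← Finset.sum_filter, Finset.filter_filter, mul_comm, ← nsmul_eq_mul]
      symm
      have : (dd S).powerset.filter (fun D => D.image Prod.fst = S' ∧ G.Good q D) =
          Finset.univ.filter
            (fun T : Finset (E × Bool) => G.Good q T ∧ T.image Prod.fst = S') := by
        ext D
        simp only [Finset.mem_filter, Finset.mem_powerset, Finset.mem_univ, true_and]
        constructor
        · rintro ⟨_, h1, h2⟩; exact ⟨h2, h1⟩
        · rintro ⟨h2, h1⟩; exact ⟨sub_dd.1 (h1 ▸ hS'), h1, h2⟩
      rw [this]
      apply Finset.sum_eq_card_nsmul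
      intro D hD
      simp only [Finset.mem_filter, Finset.mem_univ, true_and] at hD
      rw [← hD.2, G.card_fst hD.1.1]
    · intro D hD
      exact Finset.mem_powerset.2 (sub_dd.2 (Finset.mem_powerset.1 hD))
  change C.btot S = a S
  induction S using Finset.strongInduction with
  | H S ih =>
    have h1 := C.euler_btot (Fintype.card V - 1) (G.und_lin C hU) S
    simp only [G.und_U_ind hU] at h1
    rw [← ha S, ← Finset.add_sum_erase _ _ (Finset.mem_powerset_self S),
      ← Finset.add_sum_erase S.powerset _ (Finset.mem_powerset_self S)] at h1
    have h2 : ∑ D' ∈ S.powerset.erase S, (-1 : ℤ) ^ D'.card * (C.btot D' : ℤ) =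
        ∑ D' ∈ S.powerset.erase S, (-1 : ℤ) ^ D'.card * (a D' : ℤ) := by
      refine Finset.sum_congr rfl (fun D' hD' => ?_)
      rw [Finset.mem_erase, Finset.mem_powerset] at hD'
      rw [ih D' (Finset.ssubset_iff_subset_ne.2 ⟨hD'.2, hD'.1⟩)]
    rw [h2] at h1
    have h3 := add_right_cancel h1
    have h4 := mul_left_cancel₀ (pow_ne_zero _ (by norm_num : (-1 : ℤ) ≠ 0)) h3
    exact_mod_cast h4

theorem und_bet
    (hsum : ∀ Y : Finset (E × Bool),
      ∑ D ∈ Y.powerset, (-1 : ℤ) ^ D.card * (if G.Good q D then 1 else 0) =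
      (-1) ^ (Fintype.card V - 1) * (if G.Rch q Y then 1 else 0)) (i : ℕ) (S : Finset E) :
    C.bet i S = (Finset.univ.filter (fun T : Finset (E × Bool) =>
      G.IsOrientedSpanningTree q i T ∧ T.image Prod.fst = S)).card := by
  rw [C.bet_eq _ (G.und_lin C hU), G.und_btot C hU hsum]
  simp only [ost_iff]
  split_ifs with h
  · congr 1
    ext T
    simp only [Finset.mem_filter, Finset.mem_univ, true_and]
    constructor
    · rintro ⟨h1, h2⟩
      exact ⟨⟨by rw [← G.card_fst h1.1, h2, h], h1⟩, h2⟩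
    · rintro ⟨⟨_, h1⟩, h2⟩
      exact ⟨h1, h2⟩
  · symm
    rw [Finset.card_eq_zero, Finset.filter_eq_empty_iff]
    rintro T _ ⟨⟨h1, h2⟩, h3⟩
    apply h
    rw [← h3, G.card_fst h2.1, h1]

end und

theorem edgeDegOf_eq {D : Finset (E × Bool)} (h : G.NC D) :
    edgeDegOf D = SCx.ind (D.image Prod.fst) := by
  ext e
  have h1 := G.nc_not_both h e
  have h2 : e ∈ D.image Prod.fst ↔ ((e, true) ∈ D ∨ (e, false) ∈ D) := by
    simp [or_comm]
  rw [SCx.ind_apply, edgeDegOf, Finsupp.equivFunOnFinite_symm_apply_apply]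
  simp only [h2]
  by_cases ht : (e, true) ∈ D <;> by_cases hf : (e, false) ∈ D <;> simp_all

end Multigraph


theorem betti_spanningTreeIdeal
    (G : Multigraph V E) (hG : G.Connected) (q : V)
    (kk kk' : Type) [Field kk] [Field kk']
    (Res : MinFreeRes kk E (spanningTreeIdeal kk G))
    (Res' : MinFreeRes kk' (E × Bool) (orientedSpanningTreeIdeal kk' G q)) :
    -- `β_i(𝔗_G) = |𝔖_i(G,q)|` (over every base field)
    (∀ i : ℕ, Nat.card (Res.F i) =
      Nat.card {T : Finset (E × Bool) // G.IsOrientedSpanningTree q i T}) ∧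
    -- `β_i(𝔗_G^q) = |𝔖_i(G,q)|` (over every base field)
    (∀ i : ℕ, Nat.card (Res'.F i) =
      Nat.card {T : Finset (E × Bool) // G.IsOrientedSpanningTree q i T}) ∧
    -- `β_{i,n-1+i}(𝔗_G) = β_i(𝔗_G)`
    (∀ i : ℕ,
      Nat.card {g : Res.F i //
        (Res.deg i g).sum (fun _ x => x) = Fintype.card V - 1 + i} =
      Nat.card (Res.F i)) ∧
    -- `β_{i,j}(𝔗_G) = |𝔖_{i,j}(G,q)|` for every multidegree `j`
    (∀ (i : ℕ) (j : E →₀ ℕ),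
      Nat.card {g : Res.F i // Res.deg i g = j} =
      Nat.card {T : Finset (E × Bool) //
        G.IsOrientedSpanningTree q i T ∧ edgeDegOf T = j}) := by
  have hU' : ∀ b, (monomial b (1 : kk') ∈ orientedSpanningTreeIdeal kk' G q) ↔ G.Rch q b.support :=
    fun b => (mem_span_iff _ b).trans (G.exists_ost q _)
  have hU : ∀ b, (monomial b (1 : kk) ∈ spanningTreeIdeal kk G) ↔
      G.Rch q (Multigraph.dd b.support) :=
    fun b => (mem_span_iff _ b).trans (G.exists_st q _)
  have hs' : ∀ b b' : E × Bool →₀ ℕ, b.support = b'.support →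
      ((monomial b (1 : kk') ∈ orientedSpanningTreeIdeal kk' G q) ↔
        (monomial b' (1 : kk') ∈ orientedSpanningTreeIdeal kk' G q)) := by
    intro b b' h
    rw [hU', hU', h]
  have hs : ∀ b b' : E →₀ ℕ, b.support = b'.support →
      ((monomial b (1 : kk) ∈ spanningTreeIdeal kk G) ↔
        (monomial b' (1 : kk) ∈ spanningTreeIdeal kk G)) := by
    intro b b' h
    rw [hU, hU, h]
  have hsum := G.dart_sum Res'.toSCx hU'
  have hbet := G.und_bet Res.toSCx hU hsum
  have hsq : ∀ i (g : Res.F i), Res.deg i g = SCx.ind (Res.deg i g).support :=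
    fun i g => Res.toSCx.sqfree hs i g
  have hcard : ∀ P : Finset (E × Bool) → Prop,
      Nat.card {T : Finset (E × Bool) // P T} = (Finset.univ.filter P).card := by
    intro P
    rw [Nat.card_eq_fintype_card, Fintype.card_subtype]
  refine ⟨fun i => ?_, fun i => ?_, fun i => ?_, fun i j => ?_⟩
  · rw [hcard]
    refine (Res.toSCx.card_F hs i).trans ?_
    simp only [hbet]
    rw [Finset.card_eq_sum_card_fiberwise (f := fun T : Finset (E × Bool) => T.image Prod.fst)
      (t := Finset.univ) (fun _ _ => Finset.mem_coe.2 (Finset.mem_univ _))]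
    refine Finset.sum_congr rfl (fun S _ => ?_)
    rw [Finset.filter_filter]
  · rw [hcard]
    refine (Res'.toSCx.card_F hs' i).trans ?_
    simp only [G.dart_bet Res'.toSCx hU']
    rw [Finset.card_filter]
  · refine Nat.card_congr (Equiv.subtypeUnivEquiv (fun g => ?_))
    have := Res.finite i
    have hne : Res.toSCx.bet i (Res.deg i g).support ≠ 0 := by
      have : Nonempty {g' : Res.F i // Res.deg i g' = SCx.ind (Res.deg i g).support} :=
        ⟨⟨g, hsq i g⟩⟩
      have h2 : Nat.card {g' : Res.F i // Res.deg i g' = SCx.ind (Res.deg i g).support} ≠ 0 :=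
        Nat.card_pos.ne'
      exact h2
    rw [← G.und_lin Res.toSCx hU i _ hne]
    rw [Finsupp.sum, Finset.card_eq_sum_ones]
    refine Finset.sum_congr rfl (fun e he => ?_)
    rw [hsq i g, SCx.ind_apply, if_pos he]
  · have hed : ∀ T, G.IsOrientedSpanningTree q i T →
        edgeDegOf T = SCx.ind (T.image Prod.fst) :=
      fun T hT => G.edgeDegOf_eq ((G.ost_iff q i T).1 hT).2.1
    by_cases hj : ∃ S : Finset E, j = SCx.ind S
    · obtain ⟨S, rfl⟩ := hj
      rw [hcard]
      refine (hbet i S).trans ?_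
      congr 1
      ext T
      simp only [Finset.mem_filter, Finset.mem_univ, true_and]
      refine and_congr_right (fun hT => ?_)
      rw [hed T hT]
      refine ⟨fun h => by rw [h], fun h => ?_⟩
      rw [← SCx.ind_support (T.image Prod.fst), h, SCx.ind_support]
    · have h1 : IsEmpty {g : Res.F i // Res.deg i g = j} :=
        ⟨fun g => hj ⟨_, g.2.symm.trans (hsq i g.1)⟩⟩
      have h2 : IsEmpty {T : Finset (E × Bool) //
          G.IsOrientedSpanningTree q i T ∧ edgeDegOf T = j} :=
        ⟨fun T => hj ⟨_, T.2.2.symm.trans (hed T.1 T.2.1)⟩⟩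
      rw [Nat.card_of_isEmpty, Nat.card_of_isEmpty]

end
end
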